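/- Let X be a separable Hilbert space with X = Y ⊕ Z as in the setup, let φ ∈ C¹(X, ℝ) be an even functional, and let γ : [0,T] × B_k → X be a τ_k-admissible homotopy such that: γ(0,u) = u for all u ∈ B_k; γ(t,−u) = −γ(t,u); t ↦ φ(γ(t,u)) is non-increasing on [0,T] for each fixed u ∈ B_k; and γ(t,·) : B_k → γ(t,B_k) is a τ_k-homeomorphism for every t ∈ [0,T]. If sup{φ(u) : u ∈ Y_k, ‖u‖ = ρ_k} < inf{φ(u) : u ∈ Z_k, ‖u‖ ≤ r_k} with 0 < r_k < ρ_k, then γ(t, B_k) ∩ N_k ≠ ∅ for every t ∈ [0,T]. -/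

import Mathlib

open Filter Topology Metric Set
open scoped RealInnerProductSpace

noncomputable section

/-- The setup of the fountain theorem: a separable Hilbert space `X = Y ⊕ Z`,
where `Y` is a closed subspace with orthonormal (topological) basis `e`,
`Z = Yᗮ` has orthonormal (topological) basis `f`, and `P`, `Q` are the
orthogonal projections onto `Y` and `Z` respectively. -/
structure FountainSetup (X : Type*) [NormedAddCommGroup X] [InnerProductSpace ℝ X]
    [CompleteSpace X] : Type _ where
  separable : TopologicalSpace.SeparableSpace X
  Y : Submodule ℝ X
  closedY : IsClosed (Y : Set X)
  e : ℕ → X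
  f : ℕ → X
  orth_e : Orthonormal ℝ e
  orth_f : Orthonormal ℝ f
  e_mem : ∀ j, e j ∈ Y
  f_mem : ∀ j, f j ∈ Yᗮ
  span_e : (Submodule.span ℝ (Set.range e)).topologicalClosure = Y
  span_f : (Submodule.span ℝ (Set.range f)).topologicalClosure = Yᗮ
  P : X →L[ℝ] X
  Q : X →L[ℝ] X
  P_mem : ∀ u, P u ∈ Y
  Q_mem : ∀ u, Q u ∈ Yᗮ
  P_add_Q : ∀ u, P u + Q u = u

namespace FountainSetup

variable {X : Type*} [NormedAddCommGroup X] [InnerProductSpace ℝ X] [CompleteSpace X]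
variable (S : FountainSetup X)

/-- `Y_k = Y ⊕ (⊕_{j=0}^{k} ℝ f_j)`. -/
def Yk (k : ℕ) : Submodule ℝ X := S.Y ⊔ Submodule.span ℝ (S.f '' {j | j ≤ k})

/-- `Z_k` = closure of `⊕_{j=k}^{∞} ℝ f_j`. -/
def Zk (k : ℕ) : Submodule ℝ X :=
  (Submodule.span ℝ (S.f '' {j | k ≤ j})).topologicalClosure

/-- The τ-norm `‖u‖_τ = max { Σ_j 2^{-(j+1)} |⟨Pu, e_j⟩| , ‖Qu‖ }`. -/
def tauNorm (u : X) : ℝ :=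
  max (∑' j : ℕ, (1 / 2 : ℝ) ^ (j + 1) * |⟪S.P u, S.e j⟫|) ‖S.Q u‖

/-- Convergence of a sequence in the τ-topology (which is induced by the norm `tauNorm`,
hence metrizable, so sequential convergence describes it completely). -/
def TauTendsto (u : ℕ → X) (v : X) : Prop :=
  Tendsto (fun n => S.tauNorm (u n - v)) atTop (𝓝 0)

end FountainSetup

/-- Weak convergence of a sequence in a Hilbert space. -/
def WeakConv {X : Type*} [NormedAddCommGroup X] [InnerProductSpace ℝ X]
    (u : ℕ → X) (v : X) : Prop :=
  ∀ w : X, Tendsto (fun n => ⟪u n, w⟫) atTop (𝓝 ⟪v, w⟫)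

/-- `∇φ` is weakly sequentially continuous: `φ'(u_n) v → φ'(u) v` for all `v`
whenever `u_n ⇀ u` weakly. -/
def WeaklySeqContDeriv {X : Type*} [NormedAddCommGroup X] [InnerProductSpace ℝ X]
    (φ' : X → X →L[ℝ] ℝ) : Prop :=
  ∀ (u : ℕ → X) (v : X), WeakConv u v →
    ∀ w : X, Tendsto (fun n => φ' (u n) w) atTop (𝓝 (φ' v w))


/-- The ball `B_k = {u ∈ Y_k : ‖u‖ < ρ_k}`. -/
def FountainSetup.Bk {X : Type*} [NormedAddCommGroup X] [InnerProductSpace ℝ X]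
    [CompleteSpace X] (S : FountainSetup X) (k : ℕ) (ρ : ℝ) : Set X :=
  {u : X | u ∈ S.Yk k ∧ ‖u‖ < ρ}

/-- The reordered basis `ẽ_j = f_j` for `0 ≤ j ≤ k−1` and `ẽ_j = e_{j−k}` for `j ≥ k`. -/
def FountainSetup.etilde {X : Type*} [NormedAddCommGroup X] [InnerProductSpace ℝ X]
    [CompleteSpace X] (S : FountainSetup X) (k j : ℕ) : X :=
  if j < k then S.f j else S.e (j - k)

/-- The τ_k-norm `‖u‖_{τ_k} = max { Σ_j 2^{-(j+1)} |⟨P_k u, ẽ_j⟩| , ‖Q_k u‖ }, where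
`P_k`, `Q_k` are the orthogonal projections onto `Y_{k-1}` and `Z_k`. -/
def FountainSetup.tauKNorm {X : Type*} [NormedAddCommGroup X] [InnerProductSpace ℝ X]
    [CompleteSpace X] (S : FountainSetup X) (k : ℕ) (Pk Qk : X →L[ℝ] X) (u : X) : ℝ :=
  max (∑' j : ℕ, (1 / 2 : ℝ) ^ (j + 1) * |⟪Pk u, S.etilde k j⟫|) ‖Qk u‖

/-- `q` is obtained from `p` by moving one even coordinate to a neighbouring odd value. -/
def CellStep {m : ℕ} (p q : Fin m → ℤ) : Prop :=
  ∃ c, Even (p c) ∧ |q c - p c| = 1 ∧ ∀ d, d ≠ c → q d = p d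

/-- A flag of cells of the cubical lattice: `p i` encodes a cell of dimension `i`, the odd
coordinates being the directions in which the cell extends. -/
def IsCellFlag {m j : ℕ} (p : Fin (j + 1) → Fin m → ℤ) : Prop :=
  (∀ c, Even (p 0 c)) ∧ ∀ i : Fin j, CellStep (p i.castSucc) (p i.succ)

theorem CellStep.odd {m : ℕ} {p q : Fin m → ℤ} {c : Fin m} (hc : Even (p c))
    (h : |q c - p c| = 1) : Odd (q c) := by
  obtain ⟨x, hx⟩ := hc
  rw [Int.odd_iff]
  rcases (abs_eq (by norm_num)).1 h with h | h <;> omega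

theorem CellStep.reflect_top {m : ℕ} {p q : Fin m → ℤ} (h : CellStep p q) :
    CellStep p (p + p - q) ∧ p + p - q ≠ q := by
  obtain ⟨c, hc, h1, h2⟩ := h
  refine ⟨⟨c, hc, ?_, fun c' hc' => ?_⟩, fun he => ?_⟩
  · rw [← h1, ← abs_neg]
    congr 1
    simp only [Pi.sub_apply, Pi.add_apply]
    ring
  · simp only [Pi.sub_apply, Pi.add_apply, h2 c' hc']
    ring
  · have := congrFun he c
    simp only [Pi.sub_apply, Pi.add_apply] at this
    have : q c - p c = 0 := by linarith
    simp [this] at h1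

theorem CellStep.reflect_bot {m : ℕ} {p q : Fin m → ℤ} (h : CellStep p q) :
    CellStep (q + q - p) q ∧ q + q - p ≠ p := by
  obtain ⟨c, hc, h1, h2⟩ := h
  refine ⟨⟨c, ?_, ?_, fun c' hc' => ?_⟩, fun he => ?_⟩
  · simp only [Pi.sub_apply, Pi.add_apply]
    exact (Even.add_self _).sub hc
  · rw [← h1, ← abs_neg]
    congr 1
    simp only [Pi.sub_apply, Pi.add_apply]
    ring
  · simp only [Pi.sub_apply, Pi.add_apply, h2 c' hc']
    ring
  · have := congrFun he c
    simp only [Pi.sub_apply, Pi.add_apply] at this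
    have : q c - p c = 0 := by linarith
    simp [this] at h1

theorem CellStep.reflect_mid {m : ℕ} {p q r : Fin m → ℤ} (h : CellStep p q)
    (h' : CellStep q r) :
    CellStep p (p + r - q) ∧ CellStep (p + r - q) r ∧ p + r - q ≠ q := by
  obtain ⟨c, hc, h1, h2⟩ := h
  obtain ⟨d, hd, h3, h4⟩ := h'
  have hcd : c ≠ d := by
    rintro rfl
    exact (Int.not_even_iff_odd.2 (CellStep.odd hc h1)) hd
  refine ⟨⟨d, ?_, ?_, fun c' hc' => ?_⟩, ⟨c, ?_, ?_, fun c' hc' => ?_⟩, fun he => ?_⟩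
  · rwa [← h2 d hcd.symm]
  · rw [← h3]
    congr 1
    simp only [Pi.sub_apply, Pi.add_apply, h2 d hcd.symm]
    ring
  · simp only [Pi.sub_apply, Pi.add_apply, h4 c' hc']
    ring
  · simpa only [Pi.sub_apply, Pi.add_apply, h4 c hcd, add_sub_cancel_right] using hc
  · rw [← h1]
    congr 1
    simp only [Pi.sub_apply, Pi.add_apply, h4 c hcd]
    ring
  · simp only [Pi.sub_apply, Pi.add_apply, h2 c' hc']
    ring
  · have := congrFun he c
    simp only [Pi.sub_apply, Pi.add_apply, h4 c hcd] at this
    have : q c - p c = 0 := by linarith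
    simp [this] at h1

theorem CellStep.eq_of_odd {m : ℕ} {p q : Fin m → ℤ} (h : CellStep p q) {c : Fin m}
    (hc : Odd (p c)) : q c = p c := by
  obtain ⟨d, hd, -, h2⟩ := h
  refine h2 c ?_
  rintro rfl
  exact Int.not_even_iff_odd.2 hc hd

theorem CellStep.neg {m : ℕ} {p q : Fin m → ℤ} (h : CellStep p q) : CellStep (-p) (-q) := by
  obtain ⟨d, hd, h1, h2⟩ := h
  refine ⟨d, by simpa using hd, ?_, fun c' hc' => by simp [h2 c' hc']⟩
  rw [← h1, ← abs_neg]
  congr 1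
  simp only [Pi.neg_apply]
  ring

theorem IsCellFlag.neg {m j : ℕ} {p : Fin (j + 1) → Fin m → ℤ} (h : IsCellFlag p) :
    IsCellFlag (-p) :=
  ⟨fun c => by simpa using h.1 c, fun i => (h.2 i).neg⟩

theorem IsCellFlag.eq_or_odd {m j : ℕ} {p : Fin (j + 1) → Fin m → ℤ} (h : IsCellFlag p)
    (i : Fin (j + 1)) (c : Fin m) :
    p i c = p 0 c ∨ (Odd (p i c) ∧ |p i c - p 0 c| = 1) := by
  induction i using Fin.induction with
  | zero => exact Or.inl rfl
  | succ i ih =>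
    rcases ih with ih | ⟨ih, ih'⟩
    · obtain ⟨d, hd, h1, h2⟩ := h.2 i
      by_cases hcd : c = d
      · subst hcd
        exact Or.inr ⟨CellStep.odd hd h1, by rw [← ih]; exact h1⟩
      · exact Or.inl ((h2 c hcd).trans ih)
    · rw [(h.2 i).eq_of_odd ih]
      exact Or.inr ⟨ih, ih'⟩

theorem IsCellFlag.abs_sub_le {m j : ℕ} {p : Fin (j + 1) → Fin m → ℤ} (h : IsCellFlag p)
    (i i' : Fin (j + 1)) (c : Fin m) : |p i c - p i' c| ≤ 2 := by
  have h1 : |p i c - p 0 c| ≤ 1 := by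
    rcases h.eq_or_odd i c with h | h
    · simp [h]
    · exact h.2.le
  have h2 : |p i' c - p 0 c| ≤ 1 := by
    rcases h.eq_or_odd i' c with h | h
    · simp [h]
    · exact h.2.le
  rw [abs_le] at *
  constructor <;> linarith [h1.1, h1.2, h2.1, h2.2]

/-- If a coordinate of the top cell of a flag is even then it is constant along the flag. -/
theorem IsCellFlag.eq_of_even_last {m j : ℕ} {p : Fin (j + 1) → Fin m → ℤ} (h : IsCellFlag p)
    {c : Fin m} (hc : Even (p (Fin.last j) c)) (i : Fin (j + 1)) :
    p i c = p (Fin.last j) c := by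
  have key : ∀ i : Fin (j + 1), p i c = p (Fin.last j) c := by
    intro i
    induction i using Fin.reverseInduction with
    | last => rfl
    | cast i ih =>
      rw [← ih]
      obtain ⟨d, hd, h1, h2⟩ := h.2 i
      by_cases hcd : c = d
      · subst hcd
        exact absurd (ih ▸ hc) (Int.not_even_iff_odd.2 (CellStep.odd hd h1))
      · exact (h2 c hcd).symm
  exact key i

theorem CellStep.card_odd {m : ℕ} {p q : Fin m → ℤ} (h : CellStep p q) :
    (Finset.univ.filter fun c => Odd (q c)).card
      = (Finset.univ.filter fun c => Odd (p c)).card + 1 := by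
  obtain ⟨d, hd, h1, h2⟩ := h
  rw [← Finset.card_insert_of_notMem (a := d) (by simpa using hd)]
  congr 1
  ext c
  by_cases hcd : c = d
  · subst hcd
    simp [CellStep.odd hd h1]
  · simp [hcd, h2 c hcd]

theorem IsCellFlag.card_odd {m j : ℕ} {p : Fin (j + 1) → Fin m → ℤ} (h : IsCellFlag p)
    (i : Fin (j + 1)) : (Finset.univ.filter fun c => Odd (p i c)).card = i := by
  induction i using Fin.induction with
  | zero =>
    rw [Fin.val_zero, Finset.card_eq_zero, Finset.filter_eq_empty_iff]
    exact fun c _ => Int.not_odd_iff_even.2 (h.1 c)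
  | succ i ih => rw [(h.2 i).card_odd, ih]; simp

theorem IsCellFlag.odd_last {m j : ℕ} {p : Fin (j + 1) → Fin m → ℤ} (h : IsCellFlag p)
    (h0 : ∀ c : Fin m, j ≤ c → p (Fin.last j) c = 0) {c : Fin m} (hc : (c : ℕ) < j) :
    Odd (p (Fin.last j) c) := by
  have hsub : (Finset.univ.filter fun c => Odd (p (Fin.last j) c)) ⊆
      (Finset.univ.filter fun c : Fin m => (c : ℕ) < j) := by
    intro d hd
    simp only [Finset.mem_filter, Finset.mem_univ, true_and] at hd ⊢
    by_contra hlt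
    rw [h0 d (not_lt.1 hlt)] at hd
    simp at hd
  have hcard : (Finset.univ.filter fun c : Fin m => (c : ℕ) < j).card ≤ j := by
    rw [← Finset.card_map Fin.valEmbedding]
    refine (Finset.card_le_card (t := Finset.range j) ?_).trans (by simp)
    intro x hx
    simp only [Finset.mem_map, Finset.mem_filter, Finset.mem_univ, true_and] at hx
    obtain ⟨d, hd, rfl⟩ := hx
    simpa using hd
  have := Finset.eq_of_subset_of_card_le hsub (by rw [h.card_odd]; simpa using hcard)
  have hm : c ∈ (Finset.univ.filter fun c : Fin m => (c : ℕ) < j) := by simpa using hc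
  rw [← this] at hm
  simpa using hm

theorem IsCellFlag.update_zero {m j : ℕ} {p : Fin (j + 2) → Fin m → ℤ} (h : IsCellFlag p) :
    IsCellFlag (Function.update p 0 (p 1 + p 1 - p 0)) := by
  refine ⟨fun c => ?_, fun i => ?_⟩
  · simpa using (Even.add_self _).sub (h.1 c)
  · induction i using Fin.cases with
    | zero =>
      have h0 : (Fin.succ 0 : Fin (j + 2)) ≠ 0 := Fin.succ_ne_zero 0
      rw [Fin.castSucc_zero, Function.update_self, Function.update_of_ne h0]
      exact (h.2 0).reflect_bot.1
    | succ i =>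
      have h0 : i.succ.castSucc ≠ 0 := by
        rw [← Fin.succ_castSucc]
        exact Fin.succ_ne_zero _
      rw [Function.update_of_ne h0, Function.update_of_ne (Fin.succ_ne_zero _)]
      exact h.2 i.succ

theorem IsCellFlag.update_mid {m j : ℕ} {p : Fin (j + 2) → Fin m → ℤ} (h : IsCellFlag p)
    (s : Fin j) :
    IsCellFlag (Function.update p s.castSucc.succ
      (p s.castSucc.castSucc + p s.succ.succ - p s.castSucc.succ)) := by
  have hmid := (h.2 s.castSucc).reflect_mid (r := p s.succ.succ)
    (h.2 s.succ)
  refine ⟨fun c => ?_, fun i => ?_⟩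
  · rw [Function.update_of_ne (Fin.succ_ne_zero _).symm]
    exact h.1 c
  · by_cases h1 : i = s.castSucc
    · subst h1
      rw [Function.update_self, Function.update_of_ne (by simp [Fin.ext_iff])]
      exact hmid.1
    · by_cases h2 : i = s.succ
      · subst h2
        rw [← Fin.succ_castSucc, Function.update_self,
          Function.update_of_ne (by simp [Fin.ext_iff])]
        exact hmid.2.1
      · rw [Function.update_of_ne, Function.update_of_ne]
        · exact h.2 i
        · simpa using h1
        · simp only [ne_eq, Fin.ext_iff, Fin.val_succ, Fin.val_castSucc] at h2 ⊢
          exact h2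

theorem IsCellFlag.update_last {m j : ℕ} {p : Fin (j + 2) → Fin m → ℤ} (h : IsCellFlag p) :
    IsCellFlag (Function.update p (Fin.last (j + 1))
      (p (Fin.last j).castSucc + p (Fin.last j).castSucc - p (Fin.last (j + 1)))) := by
  refine ⟨fun c => ?_, fun i => ?_⟩
  · rw [Function.update_of_ne (by simp [Fin.ext_iff])]
    exact h.1 c
  · rw [Function.update_of_ne (a := i.castSucc) (by simp [Fin.ext_iff]; omega)]
    by_cases hi : i = Fin.last j
    · subst hi
      rw [Fin.succ_last, Function.update_self]
      exact (h.2 (Fin.last j)).reflect_top.1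
    · rw [Function.update_of_ne]
      · exact h.2 i
      · simpa [Fin.ext_iff] using hi

open Classical in
/-- The flags of length `j` with cells in `A` contained in the span of the first `j`
coordinates. -/
def cellFlags {m : ℕ} (A : Finset (Fin m → ℤ)) (j : ℕ) : Finset (Fin (j + 1) → Fin m → ℤ) :=
  (Fintype.piFinset fun _ => A).filter fun p =>
    IsCellFlag p ∧ ∀ i, ∀ c : Fin m, j ≤ c → p i c = 0

/-- The flags of length `j + 1` whose top cell lies on the positive side of the hyperplane
spanned by the first `j` coordinates. -/
def posCellFlags {m : ℕ} (A : Finset (Fin m → ℤ)) (j : ℕ) (hj : j < m) :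
    Finset (Fin (j + 2) → Fin m → ℤ) :=
  (cellFlags A (j + 1)).filter fun p => 0 < p (Fin.last (j + 1)) ⟨j, hj⟩

theorem mem_cellFlags {m : ℕ} {A : Finset (Fin m → ℤ)} {j : ℕ} {p : Fin (j + 1) → Fin m → ℤ} :
    p ∈ cellFlags A j ↔
      (∀ i, p i ∈ A) ∧ IsCellFlag p ∧ ∀ i, ∀ c : Fin m, j ≤ c → p i c = 0 := by
  simp [cellFlags]

theorem mem_posCellFlags {m : ℕ} {A : Finset (Fin m → ℤ)} {j : ℕ} {hj : j < m}
    {p : Fin (j + 2) → Fin m → ℤ} :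
    p ∈ posCellFlags A j hj ↔ p ∈ cellFlags A (j + 1) ∧ 0 < p (Fin.last (j + 1)) ⟨j, hj⟩ := by
  simp [posCellFlags]

/-- The mod 2 simplicial coboundary. -/
def coboundary {V : Type*} {j : ℕ} (a : (Fin (j + 1) → V) → ZMod 2) (p : Fin (j + 2) → V) :
    ZMod 2 :=
  ∑ s, a (p ∘ Fin.succAbove s)

/-- Faces paired by the involution changing the vertex `s` cancel modulo 2. -/
theorem sum_face_eq_zero {V : Type*} [AddCommGroup V] {j : ℕ} (S : Finset (Fin (j + 2) → V))
    (s : Fin (j + 2)) (f : (Fin (j + 2) → V) → V)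
    (hf : ∀ p v, f (Function.update p s v) = f p) (a : (Fin (j + 1) → V) → ZMod 2)
    (hS : ∀ p ∈ S, a (p ∘ Fin.succAbove s) ≠ 0 →
      Function.update p s (f p - p s) ∈ S ∧ f p - p s ≠ p s) :
    ∑ p ∈ S, a (p ∘ Fin.succAbove s) = 0 := by
  have hface : ∀ (p : Fin (j + 2) → V) v,
      Function.update p s v ∘ Fin.succAbove s = p ∘ Fin.succAbove s := by
    intro p v
    ext i
    simp
  rw [← Finset.sum_filter_ne_zero]
  refine Finset.sum_involution (fun p _ => Function.update p s (f p - p s)) ?_ ?_ ?_ ?_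
  · intro p hp
    rw [hface]
    exact CharTwo.add_self_eq_zero _
  · intro p hp _ he
    rw [Finset.mem_filter] at hp
    refine (hS p hp.1 hp.2).2 ?_
    simpa using congrFun he s
  · intro p hp
    rw [Finset.mem_filter] at hp ⊢
    rw [hface]
    exact ⟨(hS p hp.1 hp.2).1, hp.2⟩
  · intro p hp
    simp [hf]

/-- A tuple of cells of `A` is near the boundary of `A` if some cell outside `A` is close to all
its members. -/
def IsNearBoundary {m j : ℕ} (A : Finset (Fin m → ℤ)) (τ : Fin (j + 1) → Fin m → ℤ) : Prop :=
  (∀ i, τ i ∈ A) ∧ ∃ w ∉ A, ∀ i c, |w c - τ i c| ≤ 2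

theorem update_mem_cellFlags {m j : ℕ} {A : Finset (Fin m → ℤ)} {p : Fin (j + 2) → Fin m → ℤ}
    (hp : p ∈ cellFlags A (j + 1)) (s : Fin (j + 2)) {v : Fin m → ℤ}
    (hv : IsCellFlag (Function.update p s v)) (hv0 : ∀ c : Fin m, j + 1 ≤ c → v c = 0)
    (hn : ¬ IsNearBoundary A (p ∘ Fin.succAbove s)) :
    Function.update p s v ∈ cellFlags A (j + 1) := by
  rw [mem_cellFlags] at hp ⊢
  have hvA : v ∈ A := by
    by_contra hvA
    refine hn ⟨fun i => hp.1 _, v, hvA, fun i c => ?_⟩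
    have := hv.abs_sub_le s (s.succAbove i) c
    simpa [Function.update_of_ne (Fin.succAbove_ne s i)] using this
  refine ⟨fun i => ?_, hv, fun i c hc => ?_⟩
  · by_cases hi : i = s
    · subst hi
      simpa using hvA
    · simpa [Function.update_of_ne hi] using hp.1 i
  · by_cases hi : i = s
    · subst hi
      simpa using hv0 c hc
    · simpa [Function.update_of_ne hi] using hp.2.2 i c hc

theorem sum_top_face_posCellFlags {m j : ℕ} (A : Finset (Fin m → ℤ)) (hj : j < m)
    (a : (Fin (j + 1) → Fin m → ℤ) → ZMod 2) (ha : ∀ τ, IsNearBoundary A τ → a τ = 0) :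
    ∑ p ∈ posCellFlags A j hj, a (p ∘ Fin.succAbove (Fin.last (j + 1))) =
      ∑ p ∈ cellFlags A j, a p := by
  set c₀ : Fin m := ⟨j, hj⟩
  have hface : ∀ p : Fin (j + 2) → Fin m → ℤ,
      p ∘ Fin.succAbove (Fin.last (j + 1)) = fun i => p i.castSucc := by
    intro p
    ext i
    simp
  rw [← Finset.sum_filter_add_sum_filter_not _ (fun p => p (Fin.last j).castSucc c₀ = 0)]
  have h2 : ∑ p ∈ (posCellFlags A j hj).filter (fun p => ¬ p (Fin.last j).castSucc c₀ = 0),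
      a (p ∘ Fin.succAbove (Fin.last (j + 1))) = 0 := by
    refine sum_face_eq_zero _ _
      (fun p => p (Fin.last j).castSucc + p (Fin.last j).castSucc) ?_ _ ?_
    · intro p v
      rw [Function.update_of_ne (by simp [Fin.ext_iff])]
    · intro p hp hap
      rw [Finset.mem_filter, mem_posCellFlags] at hp
      obtain ⟨⟨hpf, hpos⟩, hne⟩ := hp
      change 0 < p (Fin.last (j + 1)) c₀ at hpos
      have hp' := mem_cellFlags.1 hpf
      have hstep : CellStep (p (Fin.last j).castSucc) (p (Fin.last (j + 1))) :=
        hp'.2.1.2 (Fin.last j)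
      refine ⟨?_, hstep.reflect_top.2⟩
      rw [Finset.mem_filter, mem_posCellFlags]
      refine ⟨⟨update_mem_cellFlags hpf _ hp'.2.1.update_last (fun c hc => ?_)
        (fun h => hap (ha _ h)), ?_⟩, ?_⟩
      · simp [hp'.2.2 _ c hc]
      · rw [Function.update_self]
        change 0 < p (Fin.last j).castSucc c₀ + p (Fin.last j).castSucc c₀ -
          p (Fin.last (j + 1)) c₀
        obtain ⟨d, ⟨x, hx⟩, h1, h3⟩ := hstep
        by_cases hd : c₀ = d
        · subst hd
          rcases (abs_eq (by norm_num)).1 h1 with h | h <;> omega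
        · rw [h3 _ hd] at hpos ⊢
          linarith
      · rwa [Function.update_of_ne (by simp [Fin.ext_iff])]
  rw [h2, add_zero, ← Finset.sum_filter_ne_zero,
    ← Finset.sum_filter_ne_zero (s := cellFlags A j)]
  refine Finset.sum_bij (fun p _ => fun i : Fin (j + 1) => p i.castSucc) ?_ ?_ ?_ ?_
  · intro p hp
    rw [Finset.mem_filter, Finset.mem_filter, mem_posCellFlags, mem_cellFlags] at hp
    obtain ⟨⟨⟨⟨hA, hfl, hsupp⟩, hpos⟩, h0⟩, hap⟩ := hp
    rw [Finset.mem_filter, mem_cellFlags]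
    have hfl' : IsCellFlag (fun i : Fin (j + 1) => p i.castSucc) :=
      ⟨hfl.1, fun i => by simpa using hfl.2 i.castSucc⟩
    refine ⟨⟨fun i => hA _, hfl', fun i c hc => ?_⟩, by rwa [hface] at hap⟩
    by_cases hc' : c = c₀
    · subst hc'
      rw [hfl'.eq_of_even_last (c := c₀) (by simp [h0]), h0]
    · refine hsupp _ c (Nat.lt_of_le_of_ne hc fun h => hc' ?_)
      exact Fin.ext h.symm
  · intro p hp q hq hpq
    rw [Finset.mem_filter, Finset.mem_filter, mem_posCellFlags, mem_cellFlags] at hp hq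
    have key : ∀ p : Fin (j + 2) → Fin m → ℤ, IsCellFlag p →
        0 < p (Fin.last (j + 1)) c₀ → p (Fin.last j).castSucc c₀ = 0 →
        p (Fin.last (j + 1)) = Function.update (p (Fin.last j).castSucc) c₀ 1 := by
      intro p hfl hpos h0
      obtain ⟨d, -, h1, h3⟩ := hfl.2 (Fin.last j)
      rw [Fin.succ_last] at h1 h3
      have hd : d = c₀ := by
        by_contra hd
        rw [h3 c₀ (Ne.symm hd), h0] at hpos
        exact lt_irrefl _ hpos
      subst hd
      ext c
      by_cases hc : c = c₀
      · subst hc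
        rw [Function.update_self]
        rw [h0, sub_zero, abs_of_pos hpos] at h1
        exact h1
      · rw [Function.update_of_ne hc, h3 c hc]
    have hlast : p (Fin.last (j + 1)) = q (Fin.last (j + 1)) := by
      rw [key p hp.1.1.1.2.1 hp.1.1.2 hp.1.2, key q hq.1.1.1.2.1 hq.1.1.2 hq.1.2]
      congr 1
      exact congrFun hpq (Fin.last j)
    funext i
    induction i using Fin.lastCases with
    | last => exact hlast
    | cast i => exact congrFun hpq i
  · intro τ hτ
    rw [Finset.mem_filter, mem_cellFlags] at hτ
    obtain ⟨⟨hA, hfl, hsupp⟩, haτ⟩ := hτ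
    set v : Fin m → ℤ := Function.update (τ (Fin.last j)) c₀ 1 with hv
    have h0 : τ (Fin.last j) c₀ = 0 := hsupp _ _ le_rfl
    have hstep : CellStep (τ (Fin.last j)) v :=
      ⟨c₀, by simp [h0], by simp [hv, h0], fun c hc => by rw [hv, Function.update_of_ne hc]⟩
    set p : Fin (j + 2) → Fin m → ℤ := Fin.snoc (α := fun _ => Fin m → ℤ) τ v with hp
    have hpl : p (Fin.last (j + 1)) = v := by simp [hp]
    have hpc : ∀ i : Fin (j + 1), p i.castSucc = τ i := by simp [hp]
    have hpfl : IsCellFlag p := by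
      refine ⟨fun c => ?_, fun i => ?_⟩
      · rw [← Fin.castSucc_zero, hpc]
        exact hfl.1 c
      · induction i using Fin.lastCases with
        | last => rwa [hpc, Fin.succ_last, hpl]
        | cast i =>
          rw [hpc, Fin.succ_castSucc, hpc]
          exact hfl.2 i
    have hvA : v ∈ A := by
      by_contra hvA
      refine haτ (ha _ ⟨hA, v, hvA, fun i c => ?_⟩)
      rw [← hpl, ← hpc]
      exact hpfl.abs_sub_le _ _ c
    refine ⟨p, ?_, funext hpc⟩
    rw [Finset.mem_filter, Finset.mem_filter, mem_posCellFlags, mem_cellFlags]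
    refine ⟨⟨⟨⟨fun i => ?_, hpfl, fun i c hc => ?_⟩, ?_⟩, ?_⟩, ?_⟩
    · induction i using Fin.lastCases with
      | last => rwa [hpl]
      | cast i => rw [hpc]; exact hA i
    · have hcc : c ≠ c₀ := by
        rintro rfl
        exact absurd hc (by simp [c₀])
      induction i using Fin.lastCases with
      | last =>
        rw [hpl, hv, Function.update_of_ne hcc]
        exact hsupp _ c (by omega)
      | cast i =>
        rw [hpc]
        exact hsupp _ c (by omega)
    · rw [hpl, hv]
      simp [c₀]
    · rw [hpc, h0]
    · rw [hface]
      simpa only [hpc] using haτ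
  · intro p hp
    rw [hface]

/-- A cochain vanishing on the tuples near the boundary of `A` has the same sum modulo 2 over the
flags of length `j` and over the boundary of the flags of length `j + 1` on one side. -/
theorem sum_coboundary_posCellFlags {m j : ℕ} (A : Finset (Fin m → ℤ)) (hj : j < m)
    (a : (Fin (j + 1) → Fin m → ℤ) → ZMod 2) (ha : ∀ τ, IsNearBoundary A τ → a τ = 0) :
    ∑ p ∈ posCellFlags A j hj, coboundary a p = ∑ p ∈ cellFlags A j, a p := by
  simp only [coboundary]
  rw [Finset.sum_comm, Fin.sum_univ_castSucc, sum_top_face_posCellFlags A hj a ha,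
    add_eq_right]
  refine Finset.sum_eq_zero fun s _ => ?_
  induction s using Fin.cases with
  | zero =>
    rw [Fin.castSucc_zero]
    refine sum_face_eq_zero _ _ (fun p => p 1 + p 1) ?_ _ ?_
    · intro p v
      rw [Function.update_of_ne (by simp)]
    · intro p hp hap
      rw [mem_posCellFlags] at hp
      have hp' := mem_cellFlags.1 hp.1
      refine ⟨mem_posCellFlags.2 ⟨update_mem_cellFlags hp.1 _ hp'.2.1.update_zero (fun c hc => ?_)
        (fun h => hap (ha _ h)), ?_⟩, (hp'.2.1.2 0).reflect_bot.2⟩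
      · simp [hp'.2.2 _ c hc]
      · rw [Function.update_of_ne (by simp [Fin.ext_iff])]
        exact hp.2
  | succ s =>
    rw [← Fin.succ_castSucc]
    refine sum_face_eq_zero _ _ (fun p => p s.castSucc.castSucc + p s.succ.succ) ?_ _ ?_
    · intro p v
      rw [Function.update_of_ne (by simp [Fin.ext_iff]),
        Function.update_of_ne (by simp [Fin.ext_iff])]
    · intro p hp hap
      rw [mem_posCellFlags] at hp
      have hp' := mem_cellFlags.1 hp.1
      refine ⟨mem_posCellFlags.2 ⟨update_mem_cellFlags hp.1 _ (hp'.2.1.update_mid s)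
        (fun c hc => ?_) (fun h => hap (ha _ h)), ?_⟩, ?_⟩
      · simp [hp'.2.2 _ c hc]
      · rw [Function.update_of_ne]
        · exact hp.2
        · simp only [ne_eq, Fin.ext_iff, Fin.val_last, Fin.val_succ, Fin.val_castSucc]
          omega
      · exact ((hp'.2.1.2 s.castSucc).reflect_mid
          (hp'.2.1.2 s.succ)).2.2

/-- The cup product of the coboundaries of `σ (j - 1), …, σ 0`, modulo 2. -/
def cupCoboundary {V : Type*} (σ : ℕ → V → ZMod 2) : (j : ℕ) → (Fin (j + 1) → V) → ZMod 2
  | 0, _ => 1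
  | j + 1, p => (σ j (p 0) + σ j (p 1)) * cupCoboundary σ j (Fin.tail p)

theorem tail_comp_succAbove_succ {V : Type*} {j : ℕ} (q : Fin (j + 3) → V) (s : Fin (j + 2)) :
    Fin.tail (q ∘ s.succ.succAbove) = Fin.tail q ∘ s.succAbove := by
  ext i
  simp [Fin.tail]

theorem coboundary_mul {V : Type*} {j : ℕ} (s : V → ZMod 2) (b : (Fin (j + 1) → V) → ZMod 2)
    (q : Fin (j + 2) → V) (hb : coboundary b q = 0) :
    coboundary (fun p => s (p 0) * b p) q = (s (q 0) + s (q 1)) * b (Fin.tail q) := by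
  have h0 : q ∘ Fin.succAbove 0 = Fin.tail q := by
    ext i
    simp [Fin.tail]
  have h1 : Fin.tail q 0 = q 1 := by simp [Fin.tail]
  have h2 : ∀ i : Fin (j + 1), (q ∘ i.succ.succAbove) 0 = q 0 := by simp
  simp only [coboundary] at hb ⊢
  rw [Fin.sum_univ_succ] at hb ⊢
  simp only [h0, h1, h2, ← Finset.mul_sum] at hb ⊢
  have two := CharTwo.two_eq_zero (R := ZMod 2)
  linear_combination s (q 0) * hb - s (q 0) * b (Fin.tail q) * two

theorem coboundary_cupCoboundary {V : Type*} (σ : ℕ → V → ZMod 2) (j : ℕ) (q : Fin (j + 2) → V) :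
    coboundary (cupCoboundary σ j) q = 0 := by
  induction j with
  | zero =>
    simp only [coboundary, cupCoboundary]
    rw [Fin.sum_univ_two]
    exact CharTwo.add_self_eq_zero _
  | succ j ih =>
    have ih' := ih (Fin.tail q)
    have h0 : q ∘ Fin.succAbove 0 = Fin.tail q := by
      ext i
      simp [Fin.tail]
    have h1 : Fin.tail q ∘ Fin.succAbove 0 = Fin.tail (Fin.tail q) := by
      ext i
      simp [Fin.tail]
    have e0 : Fin.tail q 0 = q 1 := by simp [Fin.tail]
    have e1 : Fin.tail q 1 = q 2 := by
      simp only [Fin.tail]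
      rfl
    have e2 : ∀ i : Fin (j + 2), (q ∘ i.succ.succAbove) 0 = q 0 := by simp
    have e3 : (q ∘ (0 : Fin (j + 2)).succ.succAbove) 1 = q 2 := rfl
    have e4 : ∀ i : Fin (j + 1), (q ∘ i.succ.succ.succAbove) 1 = q 1 := by
      intro i
      rw [← Fin.succ_zero_eq_one, Function.comp_apply, Fin.succ_succAbove_succ,
        Fin.succ_succAbove_zero]
      rfl
    simp only [coboundary] at ih'
    rw [Fin.sum_univ_succ, h1] at ih'
    simp only [coboundary, cupCoboundary]
    rw [Fin.sum_univ_succ, Fin.sum_univ_succ]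
    simp only [tail_comp_succAbove_succ, e2, e3, e4, h0, h1, e0, e1, ← Finset.mul_sum]
    have two := CharTwo.two_eq_zero (R := ZMod 2)
    linear_combination (σ j (q 0) + σ j (q 1)) * ih' +
      σ j (q 2) * cupCoboundary σ j (Fin.tail (Fin.tail q)) * two

theorem cupCoboundary_neg {V : Type*} [AddGroup V] (σ : ℕ → V → ZMod 2) (j : ℕ)
    (p : Fin (j + 1) → V) (h : ∀ i < j, ∀ l, σ i (-p l) = σ i (p l) + 1) :
    cupCoboundary σ j (-p) = cupCoboundary σ j p := by
  induction j with
  | zero => rfl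
  | succ j ih =>
    have ht : Fin.tail (-p) = -Fin.tail p := rfl
    have two := CharTwo.two_eq_zero (R := ZMod 2)
    simp only [cupCoboundary, Pi.neg_apply, h j (Nat.lt_succ_self j), ht]
    rw [ih (Fin.tail p) fun i hi l => h i (hi.trans (Nat.lt_succ_self j)) _]
    linear_combination cupCoboundary σ j (Fin.tail p) * two

theorem exists_ne_of_cupCoboundary_ne_zero {V : Type*} (σ : ℕ → V → ZMod 2) (j : ℕ)
    (p : Fin (j + 1) → V) (h : cupCoboundary σ j p ≠ 0) :
    ∀ i < j, ∃ l l', σ i (p l) ≠ σ i (p l') := by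
  induction j with
  | zero => exact fun i hi => absurd hi (Nat.not_lt_zero i)
  | succ j ih =>
    intro i hi
    rcases Nat.lt_succ_iff_lt_or_eq.1 hi with hi | rfl
    · obtain ⟨l, l', hl⟩ := ih (Fin.tail p) (right_ne_zero_of_mul h) i hi
      exact ⟨l.succ, l'.succ, hl⟩
    · refine ⟨0, 1, fun he => left_ne_zero_of_mul h ?_⟩
      rw [he]
      exact CharTwo.add_self_eq_zero _

theorem neg_mem_cellFlags {m j : ℕ} {A : Finset (Fin m → ℤ)} (hA : ∀ v ∈ A, -v ∈ A)
    {p : Fin (j + 1) → Fin m → ℤ} (hp : p ∈ cellFlags A j) : -p ∈ cellFlags A j := by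
  rw [mem_cellFlags] at hp ⊢
  exact ⟨fun i => hA _ (hp.1 i), hp.2.1.neg, fun i c hc => by simp [hp.2.2 i c hc]⟩

theorem sum_neg_cellFlags {m j : ℕ} {A : Finset (Fin m → ℤ)} (hA : ∀ v ∈ A, -v ∈ A)
    (a : (Fin (j + 1) → Fin m → ℤ) → ZMod 2) :
    ∑ p ∈ cellFlags A j, a (-p) = ∑ p ∈ cellFlags A j, a p :=
  Finset.sum_nbij' (fun p => -p) (fun p => -p) (fun _ hp => neg_mem_cellFlags hA hp)
    (fun _ hp => neg_mem_cellFlags hA hp) (fun _ _ => neg_neg _) (fun _ _ => neg_neg _)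
    (fun _ _ => rfl)

/-- Every flag of full length lies on exactly one side of the last coordinate hyperplane. -/
theorem sum_cellFlags_succ {m j : ℕ} {A : Finset (Fin m → ℤ)} (hA : ∀ v ∈ A, -v ∈ A) (hj : j < m)
    (a : (Fin (j + 2) → Fin m → ℤ) → ZMod 2) :
    ∑ p ∈ cellFlags A (j + 1), a p = ∑ p ∈ posCellFlags A j hj, (a p + a (-p)) := by
  rw [Finset.sum_add_distrib, ← Finset.sum_filter_add_sum_filter_not (cellFlags A (j + 1))
    (fun p => 0 < p (Fin.last (j + 1)) ⟨j, hj⟩)]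
  congr 1
  refine Finset.sum_nbij' (fun p => -p) (fun p => -p) ?_ ?_ (fun _ _ => neg_neg _)
    (fun _ _ => neg_neg _) (fun _ _ => by rw [neg_neg])
  · intro p hp
    rw [Finset.mem_filter] at hp
    refine mem_posCellFlags.2 ⟨neg_mem_cellFlags hA hp.1, ?_⟩
    have hp' := mem_cellFlags.1 hp.1
    have hodd := hp'.2.1.odd_last (fun c hc => hp'.2.2 _ c hc) (c := ⟨j, hj⟩) (by simp)
    have hne : p (Fin.last (j + 1)) ⟨j, hj⟩ ≠ 0 := by
      intro h
      simp [h] at hodd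
    simp only [Pi.neg_apply, Left.neg_pos_iff]
    exact lt_of_le_of_ne (not_lt.1 hp.2) hne
  · intro p hp
    rw [mem_posCellFlags] at hp
    rw [Finset.mem_filter]
    refine ⟨neg_mem_cellFlags hA hp.1, ?_⟩
    simp only [Pi.neg_apply, Left.neg_pos_iff, not_lt]
    exact hp.2.le

theorem sum_cupCoboundary_cellFlags_succ {m j : ℕ} {A : Finset (Fin m → ℤ)}
    (hA : ∀ v ∈ A, -v ∈ A) (hj : j < m) (σ : ℕ → (Fin m → ℤ) → ZMod 2)
    (hσ : ∀ v ∈ A, (∃ w ∉ A, ∀ c, |w c - v c| ≤ 2) → ∀ i ≤ j, σ i (-v) = σ i v + 1) :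
    ∑ p ∈ cellFlags A (j + 1), cupCoboundary σ (j + 1) p =
      ∑ p ∈ cellFlags A j, cupCoboundary σ j p := by
  set α : (Fin (j + 1) → Fin m → ℤ) → ZMod 2 := fun p => σ j (p 0) * cupCoboundary σ j p with hα
  have hδα : ∀ q, coboundary α q = cupCoboundary σ (j + 1) q := fun q =>
    coboundary_mul (σ j) _ q (coboundary_cupCoboundary σ j q)
  have two := CharTwo.two_eq_zero (R := ZMod 2)
  have key := sum_coboundary_posCellFlags A hj
    (fun p => α p + α (-p) + cupCoboundary σ j p) (by
      rintro τ ⟨hτA, w, hw, hwτ⟩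
      have hodd : ∀ i ≤ j, ∀ l, σ i (-τ l) = σ i (τ l) + 1 := fun i hi l =>
        hσ _ (hτA l) ⟨w, hw, hwτ l⟩ i hi
      simp only [hα, Pi.neg_apply, hodd j le_rfl,
        cupCoboundary_neg σ j τ fun i hi => hodd i hi.le]
      linear_combination (σ j (τ 0) * cupCoboundary σ j τ + cupCoboundary σ j τ) * two)
  have hcob : ∀ q, coboundary (fun p => α p + α (-p) + cupCoboundary σ j p) q =
      cupCoboundary σ (j + 1) q + cupCoboundary σ (j + 1) (-q) := by
    intro q
    have h1 := hδα q
    have h2 := hδα (-q)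
    have h3 := coboundary_cupCoboundary σ j q
    simp only [coboundary] at h1 h2 h3 ⊢
    rw [Finset.sum_add_distrib, Finset.sum_add_distrib, h1, h3, ← h2, add_zero]
    rfl
  rw [sum_cellFlags_succ hA hj, ← Finset.sum_congr rfl fun q _ => hcob q, key,
    Finset.sum_add_distrib, Finset.sum_add_distrib, sum_neg_cellFlags hA,
    CharTwo.add_self_eq_zero, zero_add]

/-- **Combinatorial Borsuk–Ulam lemma.** If `n` functions with values modulo 2 on a finite
symmetric set of lattice points of dimension greater than `n` are antisymmetric near its boundary,
then somewhere near the boundary all of them change value. -/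
theorem exists_isNearBoundary_forall_ne {m n : ℕ} (hnm : n < m) {A : Finset (Fin m → ℤ)}
    (hA : ∀ v ∈ A, -v ∈ A) (h0 : 0 ∈ A) (σ : ℕ → (Fin m → ℤ) → ZMod 2)
    (hσ : ∀ v ∈ A, (∃ w ∉ A, ∀ c, |w c - v c| ≤ 2) → ∀ i < n, σ i (-v) = σ i v + 1) :
    ∃ τ : Fin (n + 1) → Fin m → ℤ, IsNearBoundary A τ ∧
      ∀ i < n, ∃ l l', σ i (τ l) ≠ σ i (τ l') := by
  by_contra! hcon
  have hE : ∀ j ≤ n, ∑ p ∈ cellFlags A j, cupCoboundary σ j p = 1 := by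
    intro j
    induction j with
    | zero =>
      intro _
      have : cellFlags A 0 = {0} := by
        ext p
        rw [mem_cellFlags, Finset.mem_singleton]
        constructor
        · intro hp
          ext i c
          exact hp.2.2 i c (Nat.zero_le _)
        · rintro rfl
          exact ⟨fun _ => h0, ⟨fun _ => by simp, fun i => i.elim0⟩, fun _ _ _ => rfl⟩
      rw [this, Finset.sum_singleton]
      rfl
    | succ j ih =>
      intro hj
      rw [sum_cupCoboundary_cellFlags_succ hA (by omega) σ
        fun v hv hw i hi => hσ v hv hw i (by omega)]
      exact ih (by omega)
  have hzero := sum_coboundary_posCellFlags A hnm (cupCoboundary σ n) (by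
    intro τ hτ
    by_contra hne
    obtain ⟨i, hi, hc⟩ := hcon τ hτ
    obtain ⟨l, l', hl⟩ := exists_ne_of_cupCoboundary_ne_zero σ n τ hne i hi
    exact hl (hc l l'))
  rw [hE n le_rfl, Finset.sum_eq_zero fun q _ => coboundary_cupCoboundary σ n q] at hzero
  exact zero_ne_one hzero

/-- The nonzero vectors of an integer lattice split into two halves swapped by negation. -/
theorem exists_half_lattice (m : ℕ) :
    ∃ s : (Fin m → ℤ) → Prop, ∀ v, v ≠ 0 → (s (-v) ↔ ¬ s v) := by
  refine ⟨fun v => Encodable.encode v < Encodable.encode (-v), fun v hv => ?_⟩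
  have hne : Encodable.encode (-v) ≠ Encodable.encode v := fun he =>
    hv (neg_eq_self.1 (Encodable.encode_injective he))
  simp only [neg_neg, not_lt]
  exact ⟨le_of_lt, fun h => lt_of_le_of_ne h hne⟩

/-- One mesh of the continuous Borsuk–Ulam theorem: `n` odd functions on a symmetric bounded set
have no common strict sign on a cluster of points of size `ε` meeting the complement of the set. -/
theorem exists_cluster_sign_change {m n : ℕ} (hnm : n < m) {V : Set (Fin m → ℝ)}
    (hVb : Bornology.IsBounded V) (hVs : ∀ x ∈ V, -x ∈ V) {ε : ℝ} (hε : 0 < ε)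
    (h0 : closedBall 0 ε ⊆ V) (g : (Fin m → ℝ) → Fin n → ℝ) (hodd : ∀ x ∈ V, g (-x) = -g x) :
    ∃ (x : Fin (n + 1) → Fin m → ℝ) (w : Fin m → ℝ), (∀ l, x l ∈ V) ∧ w ∉ V ∧
      (∀ l, dist (x l) w ≤ ε) ∧
      ∀ i, ∃ l l', ¬ (0 < g (x l) i ∧ 0 < g (x l') i) ∧ ¬ (g (x l) i < 0 ∧ g (x l') i < 0) := by
  classical
  set h : ℝ := ε / 2 with hh
  have hpos : 0 < h := half_pos hε
  set sc : (Fin m → ℤ) → Fin m → ℝ := fun v c => h * v c with hsc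
  have hneg : ∀ v, sc (-v) = -sc v := by
    intro v
    ext c
    simp [hsc]
  have hdist : ∀ v w : Fin m → ℤ, (∀ c, |w c - v c| ≤ 2) → dist (sc v) (sc w) ≤ ε := by
    intro v w hvw
    rw [dist_pi_le_iff hε.le]
    intro c
    have hc : |(w c : ℝ) - v c| ≤ 2 := by exact_mod_cast hvw c
    rw [Real.dist_eq, abs_sub_comm, ← mul_sub, abs_mul, abs_of_pos hpos]
    nlinarith
  have hfin : {v : Fin m → ℤ | sc v ∈ V}.Finite := by
    obtain ⟨R, hR⟩ := hVb.subset_closedBall 0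
    obtain ⟨M, hM⟩ := exists_nat_gt (R / h)
    refine (Set.finite_Icc (fun _ => -(M : ℤ)) (fun _ => (M : ℤ))).subset fun v hv => ?_
    have hv' : ∀ c, |v c| ≤ (M : ℤ) := by
      intro c
      have h1 : ‖sc v c‖ ≤ R :=
        (norm_le_pi_norm (sc v) c).trans (by simpa using hR hv)
      rw [Real.norm_eq_abs, abs_mul, abs_of_pos hpos] at h1
      have h2 : |(v c : ℝ)| ≤ R / h := by
        rw [le_div_iff₀ hpos]
        linarith
      have h3 : |(v c : ℝ)| ≤ M := h2.trans hM.le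
      exact_mod_cast h3
    exact ⟨fun c => (abs_le.1 (hv' c)).1, fun c => (abs_le.1 (hv' c)).2⟩
  set A : Finset (Fin m → ℤ) := hfin.toFinset with hA
  have memA : ∀ v, v ∈ A ↔ sc v ∈ V := by simp [hA]
  have hsc0 : sc 0 = 0 := by
    ext c
    simp [hsc]
  have h0A : (0 : Fin m → ℤ) ∈ A := by
    rw [memA, hsc0]
    exact h0 (mem_closedBall_self hε.le)
  obtain ⟨s, hs⟩ := exists_half_lattice m
  set σ : ℕ → (Fin m → ℤ) → ZMod 2 := fun i v =>
    if hi : i < n then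
      if 0 < g (sc v) ⟨i, hi⟩ then 1 else if g (sc v) ⟨i, hi⟩ < 0 then 0 else
        if s v then 1 else 0
    else 0 with hσ
  obtain ⟨τ, ⟨hτA, w, hw, hwτ⟩, hτ⟩ := exists_isNearBoundary_forall_ne hnm
    (fun v hv => by rw [memA, hneg]; exact hVs _ ((memA v).1 hv)) h0A σ (by
      rintro v hv ⟨w, hw, hvw⟩ i hi
      have hv0 : v ≠ 0 := by
        rintro rfl
        refine hw ((memA w).2 (h0 ?_))
        rw [mem_closedBall, dist_comm, ← hsc0]
        exact hdist 0 w hvw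
      have hg : g (sc (-v)) ⟨i, hi⟩ = -g (sc v) ⟨i, hi⟩ := by
        rw [hneg, hodd _ ((memA v).1 hv)]
        rfl
      simp only [hσ, hi, dif_pos, hg, Left.neg_pos_iff, Left.neg_neg_iff, hs v hv0]
      rcases lt_trichotomy (g (sc v) ⟨i, hi⟩) 0 with h1 | h1 | h1
      · simp [h1, not_lt.2 h1.le]
      · by_cases h2 : s v
        · simp only [h1, h2, lt_irrefl, if_false, if_true, not_true_eq_false]
          decide
        · simp only [h1, h2, lt_irrefl, if_false, if_true, not_false_eq_true]
          decide
      · simp only [h1, not_lt.2 h1.le, if_true, if_false]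
        decide)
  refine ⟨fun l => sc (τ l), sc w, fun l => (memA _).1 (hτA l), fun h => hw ((memA w).2 h),
    fun l => hdist _ _ (hwτ l), fun i => ?_⟩
  obtain ⟨l, l', hl⟩ := hτ i i.2
  refine ⟨l, l', fun hc => hl ?_, fun hc => hl ?_⟩
  · simp [hσ, hc.1, hc.2]
  · simp [hσ, hc.1, hc.2, not_lt.2 hc.1.le, not_lt.2 hc.2.le]

/-- **Borsuk–Ulam theorem** for symmetric domains: an odd map from a bounded symmetric
neighbourhood of the origin to a space of smaller dimension vanishes on the frontier. -/
theorem exists_mem_frontier_eq_zero_of_odd {m n : ℕ} (hnm : n < m) {V : Set (Fin m → ℝ)}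
    (hVo : IsOpen V) (hVb : Bornology.IsBounded V) (hVs : ∀ x ∈ V, -x ∈ V) (h0 : 0 ∈ V)
    (g : (Fin m → ℝ) → Fin n → ℝ) (hg : ContinuousOn g (closure V))
    (hodd : ∀ x ∈ V, g (-x) = -g x) : ∃ x ∈ frontier V, g x = 0 := by
  obtain ⟨ε, hε, hball⟩ := nhds_basis_closedBall.mem_iff.1 (hVo.mem_nhds h0)
  have hεN : ∀ N : ℕ, 0 < ε / (N + 1) := fun N => by positivity
  choose x w hxV hwV hxw hsign using fun N : ℕ =>
    exists_cluster_sign_change hnm hVb hVs (hεN N)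
      ((closedBall_subset_closedBall (div_le_self hε.le (by simp))).trans hball) g hodd
  have hlim : Tendsto (fun N : ℕ => ε / ((N : ℝ) + 1)) atTop (𝓝 0) :=
    tendsto_const_div_atTop_nhds_zero_nat ε |>.comp (tendsto_add_atTop_nat 1) |>.congr
      fun N => by simp
  obtain ⟨x₀, hx₀, ψ, hψ, hx⟩ := tendsto_subseq_of_bounded hVb (fun N => hxV N 0)
  have hw : Tendsto (fun N => w (ψ N)) atTop (𝓝 x₀) := by
    refine hx.congr_dist (squeeze_zero (fun _ => dist_nonneg) (fun N => hxw (ψ N) 0) ?_)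
    exact hlim.comp hψ.tendsto_atTop
  have hxl : ∀ l, Tendsto (fun N => x (ψ N) l) atTop (𝓝 x₀) := by
    intro l
    refine hw.congr_dist (squeeze_zero (fun _ => dist_nonneg)
      (fun N => (dist_comm _ _).trans_le (hxw (ψ N) l)) ?_)
    exact hlim.comp hψ.tendsto_atTop
  have hx₀V : x₀ ∉ V := fun hmem => by
    obtain ⟨N, hN⟩ := (hw.eventually (hVo.mem_nhds hmem)).exists
    exact hwV _ hN
  refine ⟨x₀, by rw [hVo.frontier_eq]; exact ⟨hx₀, hx₀V⟩, funext fun i => ?_⟩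
  have hgl : ∀ l, Tendsto (fun N => g (x (ψ N) l) i) atTop (𝓝 (g x₀ i)) := by
    intro l
    refine (tendsto_pi_nhds.1 ((hg x₀ hx₀).tendsto.comp (tendsto_nhdsWithin_iff.2
      ⟨hxl l, .of_forall fun N => subset_closure (hxV _ l)⟩)) i)
  rcases lt_trichotomy (g x₀ i) 0 with h1 | h1 | h1
  · obtain ⟨N, hN⟩ := (eventually_all.2 fun l => (hgl l).eventually (gt_mem_nhds h1)).exists
    obtain ⟨l, l', -, hl⟩ := hsign (ψ N) i
    exact absurd ⟨hN l, hN l'⟩ hl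
  · exact h1
  · obtain ⟨N, hN⟩ := (eventually_all.2 fun l => (hgl l).eventually (lt_mem_nhds h1)).exists
    obtain ⟨l, l', hl, -⟩ := hsign (ψ N) i
    exact absurd ⟨hN l, hN l'⟩ hl

theorem eq_zero_of_eq_neg {E : Type*} [AddCommGroup E] [Module ℝ E] {x : E} (h : x = -x) :
    x = 0 := by
  have h2 : (2 : ℝ) • x = 0 := by
    rw [two_smul]
    nth_rewrite 1 [h]
    exact neg_add_cancel _
  exact (smul_eq_zero.1 h2).resolve_left two_ne_zero

/-- The zeros of an odd map on a symmetric open neighbourhood of the origin in a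
finite-dimensional space are never compact when the target has smaller dimension. -/
theorem not_isCompact_zeros_of_odd {E E₀ : Type*} [NormedAddCommGroup E] [NormedSpace ℝ E]
    [FiniteDimensional ℝ E] [NormedAddCommGroup E₀] [NormedSpace ℝ E₀] [FiniteDimensional ℝ E₀]
    (hlt : Module.finrank ℝ E₀ < Module.finrank ℝ E) {U : Set E} (hU : IsOpen U)
    (hUs : ∀ x ∈ U, -x ∈ U) (h0 : 0 ∈ U) (g : E → E₀) (hg : ContinuousOn g U)
    (hodd : ∀ x ∈ U, g (-x) = -g x) : ¬ IsCompact {x ∈ U | g x = 0} := by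
  intro hK
  have : ProperSpace E := FiniteDimensional.proper ℝ E
  obtain ⟨L, hL, hKL, hLU⟩ := exists_compact_between hK hU fun x hx => hx.1
  let a : E ≃L[ℝ] (Fin (Module.finrank ℝ E) → ℝ) :=
    ContinuousLinearEquiv.ofFinrankEq (by simp)
  let b : E₀ ≃L[ℝ] (Fin (Module.finrank ℝ E₀) → ℝ) :=
    ContinuousLinearEquiv.ofFinrankEq (by simp)
  set V : Set E := interior L ∩ -interior L with hV
  have hVo : IsOpen V := isOpen_interior.inter isOpen_interior.neg
  have hVL : closure V ⊆ L :=
    closure_minimal (inter_subset_left.trans interior_subset) hL.isClosed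
  have hKV : ∀ x ∈ U, g x = 0 → x ∈ V := fun x hx hgx =>
    ⟨hKL ⟨hx, hgx⟩, hKL ⟨hUs x hx, by rw [hodd x hx, hgx, neg_zero]⟩⟩
  have hVs : ∀ x ∈ V, -x ∈ V := fun x hx => ⟨hx.2, by simpa using hx.1⟩
  have hg0 : g 0 = 0 := by
    have h := hodd 0 h0
    rw [neg_zero] at h
    exact eq_zero_of_eq_neg h
  have hcl : closure (a.symm ⁻¹' V) = a.symm ⁻¹' closure V :=
    (a.symm.toHomeomorph.preimage_closure V).symm
  obtain ⟨x, hx, hgx⟩ := exists_mem_frontier_eq_zero_of_odd hlt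
    (V := a.symm ⁻¹' V) (hVo.preimage a.symm.continuous) (by
      have hb : Bornology.IsBounded (a '' L) := (hL.image a.continuous).isBounded
      refine hb.subset fun y hy => ⟨a.symm y, hVL (subset_closure hy), by simp⟩)
    (fun y hy => by simpa using hVs _ hy) (by simpa using hKV 0 h0 hg0)
    (fun y => b (g (a.symm y))) (by
      rw [hcl]
      refine b.continuous.comp_continuousOn (hg.comp a.symm.continuous.continuousOn ?_)
      exact fun y hy => hLU (hVL hy))
    (fun y hy => by
      rw [map_neg, hodd _ (hLU (hVL (subset_closure hy))), map_neg])
  rw [(hVo.preimage a.symm.continuous).frontier_eq, hcl] at hx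
  exact hx.2 (hKV _ (hLU (hVL hx.1)) (by simpa using hgx))

/-- Finite subcovers of sets that are sequentially compact for a seminorm. -/
theorem AddGroupSeminorm.exists_finset_cover {M : Type*} [AddCommGroup M] (p : AddGroupSeminorm M)
    {C : Set M} (hC : ∀ x : ℕ → M, (∀ n, x n ∈ C) → ∃ u ∈ C, ∃ ψ : ℕ → ℕ, StrictMono ψ ∧
      Tendsto (fun n => p (x (ψ n) - u)) atTop (𝓝 0))
    (a : M → ℝ) (ha : ∀ u ∈ C, 0 < a u) :
    ∃ t : Finset M, (∀ u ∈ t, u ∈ C) ∧ ∀ v ∈ C, ∃ u ∈ t, p (v - u) < a u := by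
  let _ : SeminormedAddCommGroup M := p.toSeminormedAddCommGroup
  have hseq : IsSeqCompact C := by
    intro x hx
    obtain ⟨u, hu, ψ, hψ, h⟩ := hC x hx
    refine ⟨u, hu, ψ, hψ, ?_⟩
    rw [tendsto_iff_norm_sub_tendsto_zero]
    exact h
  obtain ⟨t, ht, hcov⟩ := hseq.isCompact.elim_nhds_subcover (fun u => ball u (a u))
    fun u hu => ball_mem_nhds u (ha u hu)
  refine ⟨t, ht, fun v hv => ?_⟩
  obtain ⟨u, hu, hvu⟩ := mem_iUnion₂.1 (hcov hv)
  refine ⟨u, hu, ?_⟩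
  rw [mem_ball, dist_eq_norm] at hvu
  exact hvu

/-- Bounded sequences in a separable Hilbert space have weakly convergent subsequences. -/
theorem exists_subseq_tendsto_inner {X : Type*} [NormedAddCommGroup X] [InnerProductSpace ℝ X]
    [CompleteSpace X] [TopologicalSpace.SeparableSpace X] {R : ℝ} (x : ℕ → X)
    (hx : ∀ n, ‖x n‖ ≤ R) :
    ∃ u : X, ‖u‖ ≤ R ∧ ∃ ψ : ℕ → ℕ, StrictMono ψ ∧
      ∀ w, Tendsto (fun n => ⟪x (ψ n), w⟫) atTop (𝓝 ⟪u, w⟫) := by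
  obtain ⟨l, hl, ψ, hψ, h⟩ := WeakDual.isSeqCompact_closedBall ℝ X 0 R
    (x := fun n => StrongDual.toWeakDual (InnerProductSpace.toDual ℝ X (x n)))
    (fun n => by simpa using hx n)
  refine ⟨(InnerProductSpace.toDual ℝ X).symm (WeakDual.toStrongDual l), ?_, ψ, hψ, fun w => ?_⟩
  · simpa using hl
  · rw [InnerProductSpace.toDual_symm_apply]
    exact (WeakDual.eval_continuous w).tendsto l |>.comp h

section TauNorm

variable {X : Type*} [NormedAddCommGroup X] [InnerProductSpace ℝ X] [CompleteSpace X]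

/-- `P` and `Q` are the projections of the decomposition `X = Y_{k-1} ⊕ Z_k`, where `k ≥ 1`. -/
structure FountainSetup.IsSplitting (S : FountainSetup X) (k : ℕ) (Pk Qk : X →L[ℝ] X) : Prop where
  one_le : 1 ≤ k
  P_mem : ∀ u, Pk u ∈ S.Yk (k - 1)
  Q_mem : ∀ u, Qk u ∈ S.Zk k
  P_add_Q : ∀ u, Pk u + Qk u = u

namespace FountainSetup

variable {S : FountainSetup X} {k : ℕ} {Pk Qk : X →L[ℝ] X}

theorem inner_f_eq_zero (S : FountainSetup X) {y : X} (hy : y ∈ S.Y) (j : ℕ) :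
    ⟪S.f j, y⟫ = 0 :=
  Submodule.inner_left_of_mem_orthogonal hy (S.f_mem j)

theorem Y_le_Yk (S : FountainSetup X) (k : ℕ) : S.Y ≤ S.Yk k := le_sup_left

theorem f_mem_Yk (S : FountainSetup X) {j k : ℕ} (hj : j ≤ k) : S.f j ∈ S.Yk k :=
  (le_sup_right : _ ≤ S.Yk k) (Submodule.subset_span ⟨j, hj, rfl⟩)

theorem f_mem_Zk (S : FountainSetup X) {j k : ℕ} (hj : k ≤ j) : S.f j ∈ S.Zk k :=
  Submodule.le_topologicalClosure _ (Submodule.subset_span ⟨j, hj, rfl⟩)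

theorem Yk_le (S : FountainSetup X) {k : ℕ} {K : Submodule ℝ X} (hY : S.Y ≤ K)
    (hf : ∀ j ≤ k, S.f j ∈ K) : S.Yk k ≤ K := by
  refine sup_le hY (Submodule.span_le.2 ?_)
  rintro _ ⟨j, hj, rfl⟩
  exact hf j hj

theorem Yk_mono (S : FountainSetup X) {i k : ℕ} (hik : i ≤ k) : S.Yk i ≤ S.Yk k :=
  S.Yk_le (S.Y_le_Yk k) fun _ hj => S.f_mem_Yk (hj.trans hik)

theorem Zk_le_orthogonal_Yk (S : FountainSetup X) {i k : ℕ} (hik : i < k) :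
    S.Zk k ≤ (S.Yk i)ᗮ := by
  refine Submodule.topologicalClosure_minimal _ (Submodule.span_le.2 ?_)
    (Submodule.isClosed_orthogonal _)
  rintro _ ⟨j, hj, rfl⟩
  have hle : S.Yk i ≤ (Submodule.span ℝ {S.f j})ᗮ := by
    refine S.Yk_le (fun y hy => ?_) (fun l hl => ?_)
    · exact Submodule.mem_orthogonal_singleton_iff_inner_right.2 (S.inner_f_eq_zero hy j)
    · exact Submodule.mem_orthogonal_singleton_iff_inner_right.2
        (S.orth_f.2 (by have : k ≤ j := hj; omega))
  rw [SetLike.mem_coe, Submodule.mem_orthogonal]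
  intro u hu
  exact Submodule.mem_orthogonal_singleton_iff_inner_left.1 (hle hu)

/-- The functionals `⟨·, ẽ_j⟩` separate the points of `Y_{k-1}`. -/
theorem eq_zero_of_inner_etilde (S : FountainSetup X) (hk : 1 ≤ k) {x : X}
    (hx : x ∈ S.Yk (k - 1)) (h : ∀ j, ⟪x, S.etilde k j⟫ = 0) : x = 0 := by
  have hle : S.Yk (k - 1) ≤ (Submodule.span ℝ {x})ᗮ := by
    refine S.Yk_le ?_ fun j hj => ?_
    · conv_lhs => rw [← S.span_e]
      refine Submodule.topologicalClosure_minimal _ (Submodule.span_le.2 ?_)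
        (Submodule.isClosed_orthogonal _)
      rintro _ ⟨j, rfl⟩
      have := h (j + k)
      rw [etilde, if_neg (by omega), Nat.add_sub_cancel] at this
      exact Submodule.mem_orthogonal_singleton_iff_inner_right.2 this
    · have := h j
      rw [etilde, if_pos (by omega)] at this
      exact Submodule.mem_orthogonal_singleton_iff_inner_right.2 this
  exact inner_self_eq_zero.1 (Submodule.mem_orthogonal_singleton_iff_inner_right.1 (hle hx))

theorem norm_etilde (S : FountainSetup X) (k j : ℕ) : ‖S.etilde k j‖ = 1 := by
  rw [etilde]
  split_ifs
  exacts [S.orth_f.1 _, S.orth_e.1 _]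

theorem abs_inner_etilde_le (S : FountainSetup X) (k j : ℕ) (x : X) :
    |⟪x, S.etilde k j⟫| ≤ ‖x‖ := by
  simpa [norm_etilde] using abs_real_inner_le_norm x (S.etilde k j)

theorem tsum_half_pow_succ : ∑' j : ℕ, (1 / 2 : ℝ) ^ (j + 1) = 1 := by
  simp_rw [pow_succ]
  rw [tsum_mul_right, tsum_geometric_two]
  norm_num

theorem summable_half_pow_succ : Summable fun j : ℕ => (1 / 2 : ℝ) ^ (j + 1) :=
  (summable_nat_add_iff 1).2 summable_geometric_two

theorem summable_etilde (S : FountainSetup X) (k : ℕ) (x : X) :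
    Summable fun j : ℕ => (1 / 2 : ℝ) ^ (j + 1) * |⟪x, S.etilde k j⟫| :=
  (summable_half_pow_succ.mul_right ‖x‖).of_nonneg_of_le (fun j => by positivity)
    fun j => mul_le_mul_of_nonneg_left (S.abs_inner_etilde_le k j x) (by positivity)

theorem tauKNorm_le_max (S : FountainSetup X) (k : ℕ) (Pk Qk : X →L[ℝ] X) (u : X) :
    S.tauKNorm k Pk Qk u ≤ max ‖Pk u‖ ‖Qk u‖ := by
  refine max_le_max ?_ le_rfl
  calc _ ≤ ∑' j : ℕ, (1 / 2 : ℝ) ^ (j + 1) * ‖Pk u‖ :=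
        (S.summable_etilde k _).tsum_le_tsum
          (fun j => mul_le_mul_of_nonneg_left (S.abs_inner_etilde_le k j _) (by positivity))
          (summable_half_pow_succ.mul_right _)
    _ = ‖Pk u‖ := by rw [tsum_mul_right, tsum_half_pow_succ, one_mul]

theorem norm_Q_le_tauKNorm (S : FountainSetup X) (k : ℕ) (Pk Qk : X →L[ℝ] X) (u : X) :
    ‖Qk u‖ ≤ S.tauKNorm k Pk Qk u := le_max_right _ _

theorem abs_inner_etilde_le_tauKNorm (S : FountainSetup X) (k : ℕ) (Pk Qk : X →L[ℝ] X) (j : ℕ)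
    (u : X) : |⟪Pk u, S.etilde k j⟫| ≤ 2 ^ (j + 1) * S.tauKNorm k Pk Qk u := by
  have h : (1 / 2 : ℝ) ^ (j + 1) * |⟪Pk u, S.etilde k j⟫| ≤ S.tauKNorm k Pk Qk u :=
    ((S.summable_etilde k (Pk u)).le_tsum j fun _ _ => by positivity).trans (le_max_left _ _)
  calc |⟪Pk u, S.etilde k j⟫|
      = 2 ^ (j + 1) * ((1 / 2 : ℝ) ^ (j + 1) * |⟪Pk u, S.etilde k j⟫|) := by
        rw [← mul_assoc, ← mul_pow]
        norm_num
    _ ≤ _ := mul_le_mul_of_nonneg_left h (by positivity)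

/-- The `τ_k`-norm as an additive group seminorm. -/
def tauKSeminorm (S : FountainSetup X) (k : ℕ) (Pk Qk : X →L[ℝ] X) : AddGroupSeminorm X where
  toFun := S.tauKNorm k Pk Qk
  map_zero' := by simp [tauKNorm]
  add_le' u v := by
    refine max_le ?_ ?_
    · calc _ ≤ ∑' j : ℕ, ((1 / 2 : ℝ) ^ (j + 1) * |⟪Pk u, S.etilde k j⟫|
            + (1 / 2 : ℝ) ^ (j + 1) * |⟪Pk v, S.etilde k j⟫|) := by
            refine (S.summable_etilde k _).tsum_le_tsum (fun j => ?_)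
              ((S.summable_etilde k _).add (S.summable_etilde k _))
            rw [map_add, inner_add_left, ← mul_add]
            exact mul_le_mul_of_nonneg_left (abs_add_le _ _) (by positivity)
        _ = _ := (S.summable_etilde k _).tsum_add (S.summable_etilde k _)
        _ ≤ _ := add_le_add (le_max_left _ _) (le_max_left _ _)
    · rw [map_add]
      exact (norm_add_le _ _).trans (add_le_add (le_max_right _ _) (le_max_right _ _))
  neg' u := by simp [tauKNorm]

theorem continuous_tauKNorm (S : FountainSetup X) (k : ℕ) (Pk Qk : X →L[ℝ] X) :
    Continuous (S.tauKNorm k Pk Qk) := by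
  rw [continuous_iff_continuousAt]
  intro u
  have h0 : Tendsto (fun v => max ‖Pk (v - u)‖ ‖Qk (v - u)‖) (𝓝 u) (𝓝 0) := by
    have : Continuous fun v => max ‖Pk (v - u)‖ ‖Qk (v - u)‖ := by fun_prop
    simpa using this.tendsto u
  refine tendsto_iff_norm_sub_tendsto_zero.2
    (squeeze_zero (fun _ => norm_nonneg _) (fun v => ?_) h0)
  exact (abs_sub_map_le_sub (S.tauKSeminorm k Pk Qk) v u).trans (S.tauKNorm_le_max k Pk Qk _)

namespace IsSplitting

theorem inner_eq_zero (h : S.IsSplitting k Pk Qk) {y z : X} (hy : y ∈ S.Yk (k - 1))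
    (hz : z ∈ S.Zk k) : ⟪y, z⟫ = 0 :=
  Submodule.inner_right_of_mem_orthogonal hy
    (S.Zk_le_orthogonal_Yk (by have := h.one_le; omega) hz)

theorem Q_eq_zero (h : S.IsSplitting k Pk Qk) {y : X} (hy : y ∈ S.Yk (k - 1)) : Qk y = 0 := by
  have hQ : Qk y = y - Pk y := eq_sub_of_add_eq' (h.P_add_Q y)
  refine inner_self_eq_zero (𝕜 := ℝ).1 (h.inner_eq_zero ?_ (h.Q_mem y))
  rw [hQ]
  exact sub_mem hy (h.P_mem y)

theorem P_eq_self (h : S.IsSplitting k Pk Qk) {y : X} (hy : y ∈ S.Yk (k - 1)) : Pk y = y := by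
  simpa [h.Q_eq_zero hy] using h.P_add_Q y

theorem P_eq_zero (h : S.IsSplitting k Pk Qk) {z : X} (hz : z ∈ S.Zk k) : Pk z = 0 := by
  have hP : Pk z = z - Qk z := eq_sub_of_add_eq (h.P_add_Q z)
  refine inner_self_eq_zero (𝕜 := ℝ).1 (h.inner_eq_zero (h.P_mem z) ?_)
  rw [hP]
  exact sub_mem hz (h.Q_mem z)

theorem Q_eq_self (h : S.IsSplitting k Pk Qk) {z : X} (hz : z ∈ S.Zk k) : Qk z = z := by
  simpa [h.P_eq_zero hz] using h.P_add_Q z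

theorem mem_Zk_iff (h : S.IsSplitting k Pk Qk) {z : X} : z ∈ S.Zk k ↔ Pk z = 0 := by
  refine ⟨h.P_eq_zero, fun hz => ?_⟩
  have := h.P_add_Q z
  rw [hz, zero_add] at this
  rw [← this]
  exact h.Q_mem z

theorem mem_Yk_iff (h : S.IsSplitting k Pk Qk) {u : X} :
    u ∈ S.Yk k ↔ Qk u = ⟪S.f k, u⟫ • S.f k := by
  constructor
  · intro hu
    have hle : S.Yk k ≤ LinearMap.ker
        (Qk - (innerSL ℝ (S.f k)).smulRight (S.f k) : X →L[ℝ] X).toLinearMap := by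
      refine S.Yk_le (fun y hy => ?_) fun j hj => ?_
      · simp [h.Q_eq_zero (S.Y_le_Yk _ hy), S.inner_f_eq_zero hy]
      · rcases hj.eq_or_lt with rfl | hj
        · simp [h.Q_eq_self (S.f_mem_Zk le_rfl), S.orth_f.1]
        · simp [h.Q_eq_zero (S.f_mem_Yk (Nat.le_sub_one_of_lt hj)), S.orth_f.2 hj.ne']
    simpa [sub_eq_zero] using hle hu
  · intro hu
    rw [← h.P_add_Q u, hu]
    exact add_mem (S.Yk_mono (Nat.sub_le k 1) (h.P_mem u))
      (Submodule.smul_mem _ _ (S.f_mem_Yk le_rfl))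

theorem mem_Yk_of_tendsto_inner (h : S.IsSplitting k Pk Qk)
    {x : ℕ → X} {u : X} (hx : ∀ n, x n ∈ S.Yk k)
    (hw : ∀ w, Tendsto (fun n => ⟪x n, w⟫) atTop (𝓝 ⟪u, w⟫)) : u ∈ S.Yk k := by
  set A : X →L[ℝ] X := Qk - (innerSL ℝ (S.f k)).smulRight (S.f k) with hA
  have key : ∀ v, v ∈ S.Yk k ↔ A v = 0 := fun v => by
    rw [h.mem_Yk_iff, ← sub_eq_zero]
    simp [hA]
  rw [key]
  refine ext_inner_right ℝ fun w => ?_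
  rw [inner_zero_left, ← ContinuousLinearMap.adjoint_inner_right]
  refine tendsto_nhds_unique (hw _) (tendsto_const_nhds.congr fun n => ?_)
  rw [ContinuousLinearMap.adjoint_inner_right, (key _).1 (hx n), inner_zero_left]

/-- On bounded subsets of `Y_k`, weak convergence implies `τ_k`-convergence. -/
theorem tendsto_tauKNorm (h : S.IsSplitting k Pk Qk)
    {x : ℕ → X} {u : X} {R : ℝ} (hx : ∀ n, x n ∈ S.Yk k)
    (hR : ∀ n, ‖x n‖ ≤ R) (hw : ∀ w, Tendsto (fun n => ⟪x n, w⟫) atTop (𝓝 ⟪u, w⟫)) :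
    Tendsto (fun n => S.tauKNorm k Pk Qk (x n - u)) atTop (𝓝 0) := by
  have hu := h.mem_Yk_of_tendsto_inner hx hw
  have hw0 : ∀ w, Tendsto (fun n => ⟪x n - u, w⟫) atTop (𝓝 0) := fun w => by
    simpa [inner_sub_left] using (hw w).sub_const ⟪u, w⟫
  rw [← max_self (0 : ℝ)]
  refine Tendsto.max ?_ ?_
  · rw [← tsum_zero (α := ℝ) (β := ℕ)]
    refine tendsto_tsum_of_dominated_convergence
      (bound := fun j => (1 / 2 : ℝ) ^ (j + 1) * (‖Pk‖ * (R + ‖u‖)))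
      (summable_half_pow_succ.mul_right _) (fun j => ?_) (.of_forall fun n j => ?_)
    · have := ((hw0 (ContinuousLinearMap.adjoint Pk (S.etilde k j))).abs).const_mul
        ((1 / 2 : ℝ) ^ (j + 1))
      simpa [ContinuousLinearMap.adjoint_inner_right] using this
    · rw [Real.norm_of_nonneg (by positivity)]
      refine mul_le_mul_of_nonneg_left ((S.abs_inner_etilde_le k j _).trans ?_) (by positivity)
      refine (Pk.le_opNorm _).trans (mul_le_mul_of_nonneg_left ?_ (norm_nonneg _))
      exact (norm_sub_le _ _).trans (by linarith [hR n])
  · have hQ : ∀ n, ‖Qk (x n - u)‖ = |⟪x n - u, S.f k⟫| := fun n => by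
      rw [h.mem_Yk_iff.1 (sub_mem (hx n) hu), norm_smul, S.orth_f.1, mul_one, Real.norm_eq_abs,
        real_inner_comm]
    simp_rw [hQ]
    simpa using (hw0 (S.f k)).abs

/-- Closed balls of `Z_k` are `τ_k`-closed. -/
theorem mem_Zk_of_tendsto_tauKNorm (h : S.IsSplitting k Pk Qk)
    {y : ℕ → X} {v : X} {r : ℝ} (hy : ∀ n, y n ∈ S.Zk k)
    (hr : ∀ n, ‖y n‖ ≤ r)
    (hv : Tendsto (fun n => S.tauKNorm k Pk Qk (y n - v)) atTop (𝓝 0)) :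
    v ∈ S.Zk k ∧ ‖v‖ ≤ r := by
  have hP : Pk v = 0 := by
    refine S.eq_zero_of_inner_etilde h.one_le (h.P_mem v) fun j => abs_eq_zero.1 ?_
    refine le_antisymm (ge_of_tendsto' (by simpa using hv.const_mul (2 ^ (j + 1))) fun n => ?_)
      (abs_nonneg _)
    have := S.abs_inner_etilde_le_tauKNorm k Pk Qk j (y n - v)
    rwa [map_sub, h.P_eq_zero (hy n), zero_sub, inner_neg_left, abs_neg] at this
  have hvZ := h.mem_Zk_iff.2 hP
  refine ⟨hvZ, ?_⟩
  have hlim : Tendsto y atTop (𝓝 v) := by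
    refine tendsto_iff_norm_sub_tendsto_zero.2
      (squeeze_zero (fun _ => norm_nonneg _) (fun n => ?_) hv)
    have := S.norm_Q_le_tauKNorm k Pk Qk (y n - v)
    rwa [h.Q_eq_self (sub_mem (hy n) hvZ)] at this
  exact le_of_tendsto' hlim.norm hr

end IsSplitting

end FountainSetup

end TauNorm

namespace FountainSetup.IsSplitting

variable {X : Type*} [NormedAddCommGroup X] [InnerProductSpace ℝ X] [CompleteSpace X]
variable {S : FountainSetup X} {k : ℕ} {Pk Qk : X →L[ℝ] X} {ρ r : ℝ} {G : X → X}

/-- A `τ_k`-continuous map is continuous from the norm topology to the `τ_k`-topology. -/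
theorem continuousOn_of_tauKNorm
    (hcont : ∀ (x : ℕ → X) (u : X), (∀ n, x n ∈ S.Bk k ρ) → u ∈ S.Bk k ρ →
      Tendsto (fun n => S.tauKNorm k Pk Qk (x n - u)) atTop (𝓝 0) →
      Tendsto (fun n => S.tauKNorm k Pk Qk (G (x n) - G u)) atTop (𝓝 0)) :
    ContinuousOn (fun u => Qk (G u)) (S.Bk k ρ) ∧
      ∀ j, ContinuousOn (fun u => ⟪Pk (G u), S.etilde k j⟫) (S.Bk k ρ) := by
  have key : ∀ (x : ℕ → S.Bk k ρ) (u : S.Bk k ρ), Tendsto x atTop (𝓝 u) →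
      Tendsto (fun n => S.tauKNorm k Pk Qk (G (x n) - G u)) atTop (𝓝 0) := by
    intro x u hxu
    refine hcont _ _ (fun n => (x n).2) u.2 ?_
    have hx : Tendsto (fun n => (x n : X) - u) atTop (𝓝 0) := by
      simpa using ((continuous_subtype_val.tendsto u).comp hxu).sub_const (u : X)
    have h0 : S.tauKNorm k Pk Qk 0 = 0 := map_zero (S.tauKSeminorm k Pk Qk)
    have := ((S.continuous_tauKNorm k Pk Qk).tendsto 0).comp hx
    rwa [h0] at this
  constructor
  · rw [continuousOn_iff_continuous_domRestrict, continuous_iff_seqContinuous]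
    intro x u hxu
    refine tendsto_iff_norm_sub_tendsto_zero.2
      (squeeze_zero (fun _ => norm_nonneg _) (fun n => ?_) (key x u hxu))
    simpa using S.norm_Q_le_tauKNorm k Pk Qk (G (x n) - G u)
  · intro j
    rw [continuousOn_iff_continuous_domRestrict, continuous_iff_seqContinuous]
    intro x u hxu
    refine tendsto_iff_norm_sub_tendsto_zero.2
      (squeeze_zero (fun _ => norm_nonneg _) (fun n => ?_)
        (by simpa using (key x u hxu).const_mul (2 ^ (j + 1))))
    simpa [inner_sub_left] using S.abs_inner_etilde_le_tauKNorm k Pk Qk j (G (x n) - G u)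

/-- If `φ` separates the sphere of `Y_k` from the points mapped by `G` to the ball of `Z_k`,
these points form a weakly sequentially compact set. -/
theorem exists_subseq_tendsto_inner (h : S.IsSplitting k Pk Qk)
    (hcont : ∀ (x : ℕ → X) (u : X), (∀ n, x n ∈ S.Bk k ρ) → u ∈ S.Bk k ρ →
      Tendsto (fun n => S.tauKNorm k Pk Qk (x n - u)) atTop (𝓝 0) →
      Tendsto (fun n => S.tauKNorm k Pk Qk (G (x n) - G u)) atTop (𝓝 0))
    {φ : X → ℝ} (hφ : Continuous φ) {a b : ℝ} (hab : a < b)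
    (ha : ∀ u ∈ S.Yk k, ‖u‖ = ρ → φ u ≤ a)
    (hb : ∀ u ∈ S.Bk k ρ, G u ∈ S.Zk k → ‖G u‖ ≤ r → b ≤ φ u)
    (x : ℕ → X) (hx : ∀ n, x n ∈ S.Bk k ρ) (hxG : ∀ n, G (x n) ∈ S.Zk k)
    (hxr : ∀ n, ‖G (x n)‖ ≤ r) :
    ∃ u ∈ S.Bk k ρ, G u ∈ S.Zk k ∧ ‖G u‖ ≤ r ∧ ∃ ψ : ℕ → ℕ, StrictMono ψ ∧
      ∀ w, Tendsto (fun n => ⟪x (ψ n), w⟫) atTop (𝓝 ⟪u, w⟫) := by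
  have := S.separable
  obtain ⟨u, huρ, ψ, hψ, hw⟩ := _root_.exists_subseq_tendsto_inner x fun n => (hx n).2.le
  have huY : u ∈ S.Yk k := h.mem_Yk_of_tendsto_inner (fun n => (hx (ψ n)).1) hw
  have hlt : ‖u‖ < ρ := by
    refine lt_of_le_of_ne huρ fun he => ?_
    have hsq : Tendsto (fun n => ‖x (ψ n) - u‖ ^ 2) atTop (𝓝 0) := by
      refine squeeze_zero (fun _ => by positivity) (g := fun n => 2 * ρ ^ 2 - 2 * ⟪x (ψ n), u⟫)
        (fun n => ?_) ?_
      · rw [norm_sub_sq_real, he]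
        nlinarith [pow_le_pow_left₀ (norm_nonneg _) (hx (ψ n)).2.le 2]
      · have := ((hw u).const_mul 2).const_sub (2 * ρ ^ 2)
        rwa [real_inner_self_eq_norm_sq, he, sub_self] at this
    have hlim : Tendsto (fun n => x (ψ n)) atTop (𝓝 u) := by
      refine tendsto_iff_norm_sub_tendsto_zero.2 ?_
      simpa using hsq.sqrt
    have hge : b ≤ φ u := ge_of_tendsto' ((hφ.tendsto u).comp hlim) fun n =>
      hb _ (hx _) (hxG _) (hxr _)
    exact absurd (ha u huY he) (by linarith)
  have hτ := h.tendsto_tauKNorm (fun n => (hx (ψ n)).1) (fun n => (hx (ψ n)).2.le) hw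
  obtain ⟨huZ, hur⟩ := h.mem_Zk_of_tendsto_tauKNorm (fun n => hxG (ψ n)) (fun n => hxr (ψ n))
    (hcont _ u (fun n => hx (ψ n)) ⟨huY, hlt⟩ hτ)
  exact ⟨u, ⟨huY, hlt⟩, huZ, hur, ψ, hψ, hw⟩

/-- The intersection property for a single odd `τ_k`-continuous map with locally
finite-dimensional displacement. -/
theorem exists_norm_eq (h : S.IsSplitting k Pk Qk)
    (hr : 0 < r) (hρ : 0 < ρ)
    (hcont : ∀ (x : ℕ → X) (u : X), (∀ n, x n ∈ S.Bk k ρ) → u ∈ S.Bk k ρ →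
      Tendsto (fun n => S.tauKNorm k Pk Qk (x n - u)) atTop (𝓝 0) →
      Tendsto (fun n => S.tauKNorm k Pk Qk (G (x n) - G u)) atTop (𝓝 0))
    (hfin : ∀ u ∈ S.Bk k ρ, ∃ a : ℝ, 0 < a ∧ ∃ F : Submodule ℝ X, FiniteDimensional ℝ F ∧
      ∀ v, S.tauKNorm k Pk Qk (v - u) < a → v ∈ S.Bk k ρ → v - G v ∈ F)
    (hodd : ∀ u ∈ S.Bk k ρ, G (-u) = -G u)
    {φ : X → ℝ} (hφ : Continuous φ) {a b : ℝ} (hab : a < b)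
    (ha : ∀ u ∈ S.Yk k, ‖u‖ = ρ → φ u ≤ a)
    (hb : ∀ u ∈ S.Bk k ρ, G u ∈ S.Zk k → ‖G u‖ ≤ r → b ≤ φ u) :
    ∃ u ∈ S.Bk k ρ, G u ∈ S.Zk k ∧ ‖G u‖ = r := by
  by_contra! hne
  have hBneg : ∀ u ∈ S.Bk k ρ, -u ∈ S.Bk k ρ := fun u hu =>
    ⟨neg_mem hu.1, (norm_neg u).trans_lt hu.2⟩
  set C : Set X := {u | u ∈ S.Bk k ρ ∧ G u ∈ S.Zk k ∧ ‖G u‖ ≤ r} with hC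
  have hCneg : ∀ u ∈ C, -u ∈ C := fun u hu => by
    refine ⟨hBneg u hu.1, ?_, ?_⟩ <;> rw [hodd u hu.1]
    · exact neg_mem hu.2.1
    · rw [norm_neg]
      exact hu.2.2
  have h0B : (0 : X) ∈ S.Bk k ρ := ⟨zero_mem _, by simpa using hρ⟩
  have hG0 : G 0 = 0 := by
    have h1 := hodd 0 h0B
    rw [neg_zero] at h1
    exact eq_zero_of_eq_neg h1
  have h0C : (0 : X) ∈ C :=
    ⟨h0B, by rw [hG0]; exact zero_mem _, by rw [hG0, norm_zero]; exact hr.le⟩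
  have hCseq : ∀ x : ℕ → X, (∀ n, x n ∈ C) → ∃ u ∈ C, ∃ ψ : ℕ → ℕ, StrictMono ψ ∧
      ∀ w, Tendsto (fun n => ⟪x (ψ n), w⟫) atTop (𝓝 ⟪u, w⟫) := by
    intro x hx
    obtain ⟨u, hu, huZ, hur, hψ⟩ := h.exists_subseq_tendsto_inner hcont hφ hab ha hb x
      (fun n => (hx n).1) (fun n => (hx n).2.1) fun n => (hx n).2.2
    exact ⟨u, ⟨hu, huZ, hur⟩, hψ⟩
  choose! δ hδ F hFfin hF using hfin
  obtain ⟨s, hsC, hs⟩ := (S.tauKSeminorm k Pk Qk).exists_finset_cover (C := C) (fun x hx => by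
    obtain ⟨u, hu, ψ, hψ, hw⟩ := hCseq x hx
    exact ⟨u, hu, ψ, hψ, h.tendsto_tauKNorm (fun n => (hx (ψ n)).1.1)
      (fun n => (hx (ψ n)).1.2.le) hw⟩) δ fun u hu => hδ u hu.1
  set N : Set X := ⋃ u ∈ s, {v | S.tauKNorm k Pk Qk (v - u) < δ u} with hN
  have hNo : IsOpen N := isOpen_biUnion fun u _ => isOpen_lt
    ((S.continuous_tauKNorm k Pk Qk).comp (continuous_id.sub continuous_const)) continuous_const
  have hCN : C ⊆ N := fun v hv => by
    obtain ⟨u, hu, hvu⟩ := hs v hv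
    exact mem_iUnion₂.2 ⟨u, hu, hvu⟩
  have hFD : ∀ u : s, FiniteDimensional ℝ (F u) := fun u => hFfin u (hsC u u.2).1
  set F' : Submodule ℝ X := ⨆ u : s, F u with hF'
  have hdisp : ∀ v ∈ S.Bk k ρ, v ∈ N → v - G v ∈ F' := by
    intro v hv hvN
    obtain ⟨u, hu, hvu⟩ := mem_iUnion₂.1 hvN
    exact le_iSup (fun u : s => F u) ⟨u, hu⟩ (hF u (hsC u hu).1 v hvu hv)
  set E₀ : Submodule ℝ X := F'.map Pk.toLinearMap with hE₀
  set E : Submodule ℝ X := E₀ ⊔ Submodule.span ℝ {S.f k} with hE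
  have hE₀Y : E₀ ≤ S.Yk (k - 1) := by
    rintro _ ⟨u, -, rfl⟩
    exact h.P_mem u
  have hEY : E ≤ S.Yk k := sup_le (hE₀Y.trans (S.Yk_mono (Nat.sub_le k 1)))
    ((Submodule.span_singleton_le_iff_mem _ _).2 (S.f_mem_Yk le_rfl))
  have hPE : ∀ u ∈ E, Pk u ∈ E₀ := by
    have hle : E ≤ E₀.comap Pk.toLinearMap := by
      refine sup_le (fun y hy => ?_) ((Submodule.span_singleton_le_iff_mem _ _).2 ?_)
      · change Pk y ∈ E₀
        rwa [h.P_eq_self (hE₀Y hy)]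
      · change Pk (S.f k) ∈ E₀
        rw [h.P_eq_zero (S.f_mem_Zk le_rfl)]
        exact zero_mem _
    exact hle
  have hlt : E₀ < E := by
    refine SetLike.lt_iff_le_and_exists.2 ⟨le_sup_left, S.f k,
      (le_sup_right : _ ≤ E) (Submodule.mem_span_singleton_self _), fun hmem => ?_⟩
    have h1 := h.inner_eq_zero (hE₀Y hmem) (S.f_mem_Zk le_rfl)
    rw [real_inner_self_eq_norm_sq, S.orth_f.1] at h1
    norm_num at h1
  obtain ⟨hQc, hPc⟩ := continuousOn_of_tauKNorm hcont
  set O : Set E := {u | ‖(u : X)‖ < ρ ∧ (u : X) ∈ N ∧ -(u : X) ∈ N} with hO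
  have hOo : IsOpen O :=
    (isOpen_lt continuous_subtype_val.norm continuous_const).inter
      ((hNo.preimage continuous_subtype_val).inter (hNo.preimage continuous_subtype_val.neg))
  have hOB : ∀ u ∈ O, (u : X) ∈ S.Bk k ρ := fun u hu => ⟨hEY u.2, hu.1⟩
  have hPO : ∀ u ∈ O, Pk (G u) ∈ E₀ := fun u hu => by
    have h1 : Pk (G u) = Pk u - Pk (u - G u) := by simp
    rw [h1]
    exact sub_mem (hPE u u.2) ⟨_, hdisp u (hOB u hu) hu.2.1, rfl⟩
  set U : Set E := O ∩ {u | ‖Qk (G u)‖ < r} with hU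
  have hUo : IsOpen U :=
    ((hQc.comp continuous_subtype_val.continuousOn hOB).norm).isOpen_inter_preimage hOo isOpen_Iio
  set g : E → E₀ := fun u => E₀.orthogonalProjectionOnto (Pk (G u)) with hg
  have hgcoe : ∀ u ∈ O, (g u : X) = Pk (G u) := fun u hu =>
    Submodule.starProjection_eq_self_iff.2 (hPO u hu)
  have hgc : ContinuousOn g U := by
    let c : E₀ →ₗ[ℝ] (ℕ → ℝ) :=
      LinearMap.pi fun j => ((innerSL ℝ (S.etilde k j)).toLinearMap).comp E₀.subtype
    have hc : Topology.IsClosedEmbedding c := by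
      refine LinearMap.isClosedEmbedding_of_injective (LinearMap.ker_eq_bot'.2 fun v hv => ?_)
      refine Subtype.ext (S.eq_zero_of_inner_etilde h.one_le (hE₀Y v.2) fun j => ?_)
      rw [real_inner_comm]
      exact congrFun hv j
    rw [hc.isInducing.continuousOn_iff, continuousOn_pi]
    intro j
    refine (((hPc j).comp continuous_subtype_val.continuousOn hOB).mono
      inter_subset_left).congr fun u hu => ?_
    change ⟪S.etilde k j, (g u : X)⟫ = ⟪Pk (G u), S.etilde k j⟫
    rw [hgcoe u hu.1, real_inner_comm]
  have hodd' : ∀ u ∈ U, G ((-u : E) : X) = -G u := fun u hu => hodd u (hOB u hu.1)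
  have hUneg : ∀ u ∈ U, -u ∈ U := by
    intro u hu
    refine ⟨⟨by simpa using hu.1.1, hu.1.2.2, by simpa using hu.1.2.1⟩, ?_⟩
    rw [mem_ofPred_eq, hodd' u hu, map_neg, norm_neg]
    exact hu.2
  have hCU : ∀ u : E, (u : X) ∈ C → u ∈ U := by
    intro u hu
    refine ⟨⟨hu.1.2, hCN hu, hCN (hCneg u hu)⟩, ?_⟩
    rw [mem_ofPred_eq, h.Q_eq_self hu.2.1]
    exact lt_of_le_of_ne hu.2.2 (hne u hu.1 hu.2.1)
  have hzero : {u ∈ U | g u = 0} = {u : E | (u : X) ∈ C} := by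
    ext u
    constructor
    · rintro ⟨hu, hgu⟩
      have hP : Pk (G u) = 0 := by
        rw [← hgcoe u hu.1, hgu]
        rfl
      have hZ := h.mem_Zk_iff.2 hP
      have hur : ‖Qk (G u)‖ < r := hu.2
      rw [h.Q_eq_self hZ] at hur
      exact ⟨hOB u hu.1, hZ, hur.le⟩
    · intro hu
      refine ⟨hCU u hu, Subtype.ext ?_⟩
      rw [hgcoe u (hCU u hu).1, h.P_eq_zero hu.2.1]
      rfl
  refine not_isCompact_zeros_of_odd (Submodule.finrank_lt_finrank_of_lt hlt) hUo hUneg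
    (hCU 0 h0C) g hgc (fun u hu => by simp only [hg, hodd' u hu, map_neg]) ?_
  rw [hzero]
  refine IsSeqCompact.isCompact fun x hx => ?_
  obtain ⟨u, hu, ψ, hψ, hw⟩ := hCseq (fun n => x n) hx
  have hbd : Bornology.IsBounded (closedBall (0 : E) ρ) := isBounded_closedBall
  obtain ⟨v, -, χ, hχ, hv⟩ := tendsto_subseq_of_bounded hbd (x := x ∘ ψ) fun n => by
    simpa using (hx (ψ n)).1.2.le
  have hv' : Tendsto (fun n => (x (ψ (χ n)) : X)) atTop (𝓝 v) :=
    (continuous_subtype_val.tendsto v).comp hv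
  have huv : (v : X) = u := ext_inner_right ℝ fun w =>
    tendsto_nhds_unique (hv'.inner tendsto_const_nhds) ((hw w).comp hχ.tendsto_atTop)
  refine ⟨v, ?_, ψ ∘ χ, hψ.comp hχ, hv⟩
  rw [mem_ofPred_eq, huv]
  exact hu

end FountainSetup.IsSplitting

/-- **Intersection lemma (Lemma 2.4, Rupp).**  Let `φ ∈ C¹(X, ℝ)` be even and let
`γ : [0,T] × B_k → X` be a τ_k-admissible homotopy with `γ(0,·) = id`, odd in `u`,
with `t ↦ φ(γ(t,u))` non-increasing, such that `γ(t,·) : B_k → γ(t,B_k)` is a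
τ_k-homeomorphism.  If `sup {φ(u) : u ∈ Y_k, ‖u‖ = ρ_k} < inf {φ(u) : u ∈ Z_k, ‖u‖ ≤ r_k}`
with `0 < r_k < ρ_k`, then `γ(t, B_k) ∩ N_k ≠ ∅` for every `t ∈ [0,T]`. -/
theorem intersection_lemma
    {X : Type*} [NormedAddCommGroup X] [InnerProductSpace ℝ X] [CompleteSpace X]
    (S : FountainSetup X) (φ : X → ℝ) (φ' : X → X →L[ℝ] ℝ)
    -- φ ∈ C¹(X, ℝ)
    (hderiv : ∀ u, HasFDerivAt φ (φ' u) u) (hC1 : Continuous φ')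
    -- φ is even
    (heven : ∀ u, φ (-u) = φ u)
    (k : ℕ) (hk : 1 ≤ k)
    -- P_k, Q_k : the orthogonal projections onto Y_{k-1} and Z_k
    (Pk Qk : X →L[ℝ] X)
    (hPk : ∀ u, Pk u ∈ S.Yk (k - 1)) (hQk : ∀ u, Qk u ∈ S.Zk k)
    (hPQk : ∀ u, Pk u + Qk u = u)
    (horth : ∀ u v : X, ⟪Pk u, Qk v⟫ = 0)
    (ρkv rkv : ℝ) (hr : 0 < rkv) (hρr : rkv < ρkv)
    (T : ℝ) (hT : 0 < T) (γ : ℝ → X → X)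
    -- γ is τ_k-continuous
    (hcont : ∀ (tm : ℕ → ℝ) (um : ℕ → X) (t : ℝ) (u : X),
      (∀ m, tm m ∈ Icc (0:ℝ) T) → (∀ m, um m ∈ S.Bk k ρkv) →
      t ∈ Icc (0:ℝ) T → u ∈ S.Bk k ρkv →
      Tendsto tm atTop (𝓝 t) →
      Tendsto (fun m => S.tauKNorm k Pk Qk (um m - u)) atTop (𝓝 0) →
      Tendsto (fun m => S.tauKNorm k Pk Qk (γ (tm m) (um m) - γ t u)) atTop (𝓝 0))
    -- γ has locally finite-dimensional displacement in the |·| × τ_k topology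
    (hfin : ∀ t ∈ Icc (0:ℝ) T, ∀ u ∈ S.Bk k ρkv,
      ∃ a : ℝ, 0 < a ∧ ∃ F : Submodule ℝ X, FiniteDimensional ℝ F ∧
        ∀ s : ℝ, ∀ v : X, |s - t| < a → S.tauKNorm k Pk Qk (v - u) < a →
          s ∈ Icc (0:ℝ) T → v ∈ S.Bk k ρkv → v - γ s v ∈ F)
    -- γ(0,u) = u
    (hγ0 : ∀ u ∈ S.Bk k ρkv, γ 0 u = u)
    -- γ(t,−u) = −γ(t,u)
    (hodd : ∀ t ∈ Icc (0:ℝ) T, ∀ u ∈ S.Bk k ρkv, γ t (-u) = -γ t u)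
    -- t ↦ φ(γ(t,u)) is non-increasing
    (hmono : ∀ u ∈ S.Bk k ρkv, AntitoneOn (fun t => φ (γ t u)) (Icc (0:ℝ) T))
    -- γ(t,·) : B_k → γ(t,B_k) is a τ_k-homeomorphism
    (hhomeo : ∀ t ∈ Icc (0:ℝ) T, Set.InjOn (γ t) (S.Bk k ρkv) ∧
      ∀ (um : ℕ → X) (u : X), (∀ m, um m ∈ S.Bk k ρkv) → u ∈ S.Bk k ρkv →
        Tendsto (fun m => S.tauKNorm k Pk Qk (γ t (um m) - γ t u)) atTop (𝓝 0) →
        Tendsto (fun m => S.tauKNorm k Pk Qk (um m - u)) atTop (𝓝 0))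
    -- sup {φ(u) : u ∈ Y_k, ‖u‖ = ρ_k} < inf {φ(u) : u ∈ Z_k, ‖u‖ ≤ r_k}
    (hsep : ∃ a b : ℝ, a < b ∧ (∀ u ∈ S.Yk k, ‖u‖ = ρkv → φ u ≤ a) ∧
      (∀ u ∈ S.Zk k, ‖u‖ ≤ rkv → b ≤ φ u)) :
    -- γ(t, B_k) ∩ N_k ≠ ∅ for every t ∈ [0,T]
    ∀ t ∈ Icc (0:ℝ) T, ∃ u ∈ S.Bk k ρkv, γ t u ∈ S.Zk k ∧ ‖γ t u‖ = rkv := by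
  obtain ⟨a, b, hab, ha, hb⟩ := hsep
  intro t ht
  have h : S.IsSplitting k Pk Qk := ⟨hk, hPk, hQk, hPQk⟩
  refine h.exists_norm_eq (G := γ t) hr (hr.trans hρr)
    (fun x u hx hu => hcont (fun _ => t) x t u (fun _ => ht) hx ht hu tendsto_const_nhds)
    (fun u hu => ?_) (hodd t ht)
    (continuous_iff_continuousAt.2 fun u => (hderiv u).continuousAt) hab ha fun u hu hZ hle => ?_
  · obtain ⟨δ, hδ, F, hF, hv⟩ := hfin t ht u hu
    exact ⟨δ, hδ, F, hF, fun v hvu hvB => hv t v (by simpa using hδ) hvu ht hvB⟩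
  · have hle0 := hmono u hu (left_mem_Icc.2 hT.le) ht ht.1
    simp only [hγ0 u hu] at hle0
    exact (hb _ hZ hle).trans hle0

end
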